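/- arXiv:0811.2277 — 6 statements merged into one kernel-verified Lean document; each statement's English description precedes it below -/
import Mathlib

section
/- Let u : ℍ → ℝ be H-convex and g₀ ∈ ℍ. Then ∂_H u(g₀) ≠ ∅ if and only if there exists p ∈ ℝ² such that u(g) ≥ u(g₀) + ⟨p, ξ₁(g) − ξ₁(g₀)⟩ + o(|ξ₁(g) − ξ₁(g₀)|) as g → g₀ with g ∈ H_{g₀}; precisely, for every ε > 0 there exists δ > 0 such that u(g) ≥ u(g₀) + ⟨p, ξ₁(g) − ξ₁(g₀)⟩ − ε|ξ₁(g) − ξ₁(g₀)| for all g ∈ H_{g₀} with |ξ₁(g) − ξ₁(g₀)| < δ. -/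
noncomputable section

open Filter Topology Set
open scoped ENNReal

/-- The underlying set of the Heisenberg group `ℍ = ℝ³`, points `(x, y, t)`. -/
abbrev Hgrp : Type := ℝ × ℝ × ℝ

/-- Heisenberg group law `(x,y,t)·(x',y',t') = (x+x', y+y', t+t'+2(x'y−xy'))`. -/
def hmul (g g' : Hgrp) : Hgrp :=
  (g.1 + g'.1, g.2.1 + g'.2.1,
    g.2.2 + g'.2.2 + 2 * (g'.1 * g.2.1 - g.1 * g'.2.1))

/-- Inverse in the Heisenberg group. -/
def hinv (g : Hgrp) : Hgrp := (-g.1, -g.2.1, -g.2.2)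

/-- Anisotropic dilation `δ_λ(x,y,t) = (λx, λy, λ²t)`. -/
def hdil (l : ℝ) (g : Hgrp) : Hgrp := (l * g.1, l * g.2.1, l ^ 2 * g.2.2)

/-- Horizontal projection `ξ₁(x,y,t) = (x,y)`. -/
def xi1 (g : Hgrp) : ℝ × ℝ := (g.1, g.2.1)

/-- Exponential of a horizontal vector: `exp (a,b) = (a,b,0)`. -/
def hexp (v : ℝ × ℝ) : Hgrp := (v.1, v.2, 0)

/-- Euclidean inner product on `ℝ²`. -/
def dot (p q : ℝ × ℝ) : ℝ := p.1 * q.1 + p.2 * q.2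

/-- Euclidean norm on `ℝ²`. -/
def enorm2 (p : ℝ × ℝ) : ℝ := Real.sqrt (p.1 ^ 2 + p.2 ^ 2)

/-- The horizontal plane `H_{g₀} = {(x,y,t) : t = t₀ + 2y₀x − 2x₀y}`. -/
def hplane (g0 : Hgrp) : Set Hgrp :=
  {g | g.2.2 = g0.2.2 + 2 * g0.2.1 * g.1 - 2 * g0.1 * g.2.1}

/-- The H-subdifferential `∂_H u(g₀)` of `u : Ω → ℝ` at `g₀`. -/
def hsub (Ω : Set Hgrp) (u : Hgrp → ℝ) (g0 : Hgrp) : Set (ℝ × ℝ) :=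
  {p | ∀ g ∈ hplane g0 ∩ Ω, u g ≥ u g0 + dot p (xi1 g - xi1 g0)}

/-- The H-normal map: `∂_H u(E) = ⋃_{g ∈ E} ∂_H u(g)`. -/
def hsubSet (Ω : Set Hgrp) (u : Hgrp → ℝ) (E : Set Hgrp) : Set (ℝ × ℝ) :=
  ⋃ g ∈ E, hsub Ω u g

/-- H-convexity of a set. -/
def HConvexSet (Ω : Set Hgrp) : Prop :=
  ∀ g ∈ Ω, ∀ g' ∈ hplane g ∩ Ω, ∀ l ∈ Set.Icc (0:ℝ) 1,
    hmul g (hdil l (hmul (hinv g) g')) ∈ Ω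

/-- H-convexity (weak H-convexity) of a function on `Ω`. -/
def HConvexOn (Ω : Set Hgrp) (u : Hgrp → ℝ) : Prop :=
  ∀ g ∈ Ω, ∀ g' ∈ hplane g ∩ Ω, ∀ l ∈ Set.Icc (0:ℝ) 1,
    u (hmul g (hdil l (hmul (hinv g) g'))) ≤ u g + l * (u g' - u g)

/-- Strict H-convexity of a function on all of `ℍ`. -/
def StrictHConvexOn (u : Hgrp → ℝ) : Prop :=
  HConvexOn Set.univ u ∧
    ∀ g : Hgrp, ∀ g' ∈ hplane g, g ≠ g' → ∀ l ∈ Set.Icc (0:ℝ) 1,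
      u (hmul g (hdil l (hmul (hinv g) g'))) = u g + l * (u g' - u g) →
        l = 0 ∨ l = 1

/-- The Korányi gauge `‖(x,y,t)‖_ℍ = ((x²+y²)² + t²)^{1/4}`. -/
def kgauge (g : Hgrp) : ℝ := ((g.1 ^ 2 + g.2.1 ^ 2) ^ 2 + g.2.2 ^ 2) ^ ((1:ℝ)/4)

/-- The Korányi distance `ρ(g,g') = ‖g⁻¹·g'‖_ℍ`. -/
def kdist (g g' : Hgrp) : ℝ := kgauge (hmul (hinv g) g')

/-- A function on `ℍ` is radial if `u(x,y,t) = U(√(x²+y²), t)`. -/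
def IsRadial (u : Hgrp → ℝ) : Prop :=
  ∃ U : ℝ × ℝ → ℝ, ∀ x y t : ℝ, u (x, y, t) = U (Real.sqrt (x ^ 2 + y ^ 2), t)

/-- Horizontal derivative `Xu = ∂u/∂x + 2y ∂u/∂t`. -/
def Xd (u : Hgrp → ℝ) (g : Hgrp) : ℝ :=
  fderiv ℝ u g (1, 0, 0) + 2 * g.2.1 * fderiv ℝ u g (0, 0, 1)

/-- Horizontal derivative `Yu = ∂u/∂y − 2x ∂u/∂t`. -/
def Yd (u : Hgrp → ℝ) (g : Hgrp) : ℝ :=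
  fderiv ℝ u g (0, 1, 0) - 2 * g.1 * fderiv ℝ u g (0, 0, 1)

/-- Difference quotient of `u` at `g` in the `X` direction. -/
def XdiffQuot (u : Hgrp → ℝ) (g : Hgrp) (l : ℝ) : ℝ := (u (hmul g (l, 0, 0)) - u g) / l

/-- Difference quotient of `u` at `g` in the `Y` direction. -/
def YdiffQuot (u : Hgrp → ℝ) (g : Hgrp) (l : ℝ) : ℝ := (u (hmul g (0, l, 0)) - u g) / l

/-- Existence of the two-sided limit `Xu(g)`. -/
def XlimExists (u : Hgrp → ℝ) (g : Hgrp) : Prop :=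
  ∃ a : ℝ, Filter.Tendsto (XdiffQuot u g) (nhdsWithin 0 {0}ᶜ) (nhds a)

/-- Existence of the two-sided limit `Yu(g)`. -/
def YlimExists (u : Hgrp → ℝ) (g : Hgrp) : Prop :=
  ∃ a : ℝ, Filter.Tendsto (YdiffQuot u g) (nhdsWithin 0 {0}ᶜ) (nhds a)

/-- The value `Xu(g)` (defined via choice where the limit exists, else `0`). -/
def XuVal (u : Hgrp → ℝ) (g : Hgrp) : ℝ :=
  haveI := Classical.dec (XlimExists u g)
  if h : XlimExists u g then h.choose else 0

/-- The value `Yu(g)`. -/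
def YuVal (u : Hgrp → ℝ) (g : Hgrp) : ℝ :=
  haveI := Classical.dec (YlimExists u g)
  if h : YlimExists u g then h.choose else 0

/-- The horizontal gradient `𝕏u(g) = (Xu(g), Yu(g))`. -/
def XXgrad (u : Hgrp → ℝ) (g : Hgrp) : ℝ × ℝ := (XuVal u g, YuVal u g)

/-- The circle `C(t,R) = {(x,y,t) : x²+y² = R²}`. -/
def Ccirc (t R : ℝ) : Set Hgrp := {g | g.2.2 = t ∧ g.1 ^ 2 + g.2.1 ^ 2 = R ^ 2}

/-- A disc (open or closed) in `ℝ²` centered at the origin, of radius `R ∈ [0,∞]`. -/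
def IsCenteredDisc (S : Set (ℝ × ℝ)) : Prop :=
  ∃ R : ℝ≥0∞, S = {p : ℝ × ℝ | ENNReal.ofReal (enorm2 p) < R} ∨
    S = {p : ℝ × ℝ | ENNReal.ofReal (enorm2 p) ≤ R}

/-- Diameter of a subset of `ℍ` with respect to the Korányi distance. -/
def kdiam (S : Set Hgrp) : ℝ≥0∞ :=
  ⨆ a ∈ S, ⨆ b ∈ S, ENNReal.ofReal (kdist a b)

/-- The 2-dimensional Hausdorff (outer) measure of the metric space `(ℍ, ρ)`. -/
def kHaus2 (S : Set Hgrp) : ℝ≥0∞ :=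
  ⨆ (ε : ℝ≥0∞) (_ : 0 < ε),
    ⨅ (c : ℕ → Set Hgrp) (_ : S ⊆ ⋃ n, c n) (_ : ∀ n, kdiam (c n) ≤ ε),
      ∑' n, (kdiam (c n)) ^ 2

/-- The set `D` of points of `Ω` where both horizontal derivatives exist. -/
def Dset (Ω : Set Hgrp) (u : Hgrp → ℝ) : Set Hgrp :=
  {g ∈ Ω | XlimExists u g ∧ YlimExists u g}

/-- The level set `Σ^E_v = {g ∈ E ∩ D : 𝕏u(g) = v}`. -/
def SigmaSet (Ω : Set Hgrp) (u : Hgrp → ℝ) (E : Set Hgrp) (v : ℝ × ℝ) : Set Hgrp :=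
  {g ∈ E ∩ Dset Ω u | XXgrad u g = v}

/-- The Monge–Ampère set function `ν_u(E) = ∫_{ℝ²} 𝓗²_ρ(Σ^E_v) dv`. -/
def nuMA (Ω : Set Hgrp) (u : Hgrp → ℝ) (E : Set Hgrp) : ℝ≥0∞ :=
  ∫⁻ v : ℝ × ℝ, kHaus2 (SigmaSet Ω u E v)

theorem enorm2_nonneg (p : ℝ × ℝ) : 0 ≤ enorm2 p := Real.sqrt_nonneg _

theorem enorm2_smul {l : ℝ} (hl : 0 ≤ l) (p : ℝ × ℝ) : enorm2 (l • p) = l * enorm2 p := by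
  have h : (l • p).1 ^ 2 + (l • p).2 ^ 2 = l ^ 2 * (p.1 ^ 2 + p.2 ^ 2) := by
    simp only [Prod.smul_fst, Prod.smul_snd, smul_eq_mul]
    ring
  rw [enorm2, h, Real.sqrt_mul (sq_nonneg l), Real.sqrt_sq hl, enorm2]

theorem dot_smul (l : ℝ) (p q : ℝ × ℝ) : dot p (l • q) = l * dot p q := by
  simp only [dot, Prod.smul_fst, Prod.smul_snd, smul_eq_mul]
  ring

theorem xi1_segment (g g' : Hgrp) (l : ℝ) :
    xi1 (hmul g (hdil l (hmul (hinv g) g'))) - xi1 g = l • (xi1 g' - xi1 g) := by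
  ext <;> simp only [xi1, hmul, hdil, hinv, Prod.fst_sub, Prod.snd_sub, Prod.smul_fst,
    Prod.smul_snd, smul_eq_mul] <;> ring

/-- Horizontal segments issuing from `g` stay in the horizontal plane of `g`. -/
theorem segment_mem_hplane {g g' : Hgrp} (h : g' ∈ hplane g) (l : ℝ) :
    hmul g (hdil l (hmul (hinv g) g')) ∈ hplane g := by
  simp only [hplane, mem_ofPred_eq] at h
  simp only [hplane, mem_ofPred_eq, hmul, hdil, hinv, h]
  ring

/-- For an H-convex function, a first-order lower bound at `g0` up to a little-o term along the
horizontal plane is a global lower bound on that plane. -/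
theorem HConvexOn.mem_hsub_of_littleO {u : Hgrp → ℝ} (hconv : HConvexOn Set.univ u) {g0 : Hgrp}
    {p : ℝ × ℝ}
    (hp : ∀ ε > (0:ℝ), ∃ δ > (0:ℝ), ∀ g ∈ hplane g0,
      enorm2 (xi1 g - xi1 g0) < δ →
        u g ≥ u g0 + dot p (xi1 g - xi1 g0) - ε * enorm2 (xi1 g - xi1 g0)) :
    p ∈ hsub Set.univ u g0 := by
  rintro g ⟨hg, -⟩
  have hN := enorm2_nonneg (xi1 g - xi1 g0)
  refine le_of_forall_pos_le_add fun η hη => ?_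
  obtain ⟨δ, hδ, H⟩ := hp (η / (enorm2 (xi1 g - xi1 g0) + 1)) (by positivity)
  set N := enorm2 (xi1 g - xi1 g0)
  have hl : 0 < δ / (N + δ) := by positivity
  have hl1 : δ / (N + δ) ≤ 1 := (div_le_one (by positivity)).2 (by linarith)
  have hlN : δ / (N + δ) * N < δ := by
    rw [div_mul_eq_mul_div, div_lt_iff₀ (by positivity)]
    nlinarith
  set l := δ / (N + δ)
  have hupper := hconv g0 (mem_univ _) g ⟨hg, mem_univ _⟩ l ⟨hl.le, hl1⟩
  have hlower := H _ (segment_mem_hplane hg l)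
  rw [xi1_segment, enorm2_smul hl.le, dot_smul] at hlower
  have hlower := hlower hlN
  have hε : η / (N + 1) * N ≤ η := by
    rw [div_mul_eq_mul_div, div_le_iff₀ (by positivity)]
    nlinarith
  have hscaled : l * (dot p (xi1 g - xi1 g0) - η / (N + 1) * N) ≤ l * (u g - u g0) := by
    linarith
  linarith [le_of_mul_le_mul_left hscaled hl]

/-- For an H-convex `u : ℍ → ℝ`, the H-subdifferential at `g₀` is nonempty
iff `u` is H-subdifferentiable at `g₀` in the little-o sense along the horizontal plane. -/
theorem stmt0 (u : Hgrp → ℝ) (hconv : HConvexOn Set.univ u) (g0 : Hgrp) :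
    (hsub Set.univ u g0).Nonempty ↔
      ∃ p : ℝ × ℝ, ∀ ε > (0:ℝ), ∃ δ > (0:ℝ), ∀ g ∈ hplane g0,
        enorm2 (xi1 g - xi1 g0) < δ →
          u g ≥ u g0 + dot p (xi1 g - xi1 g0) - ε * enorm2 (xi1 g - xi1 g0) := by
  constructor
  · rintro ⟨p, hp⟩
    refine ⟨p, fun ε hε => ⟨1, one_pos, fun g hg _ => ?_⟩⟩
    linarith [hp g ⟨hg, mem_univ g⟩, mul_nonneg hε.le (enorm2_nonneg (xi1 g - xi1 g0))]
  · rintro ⟨p, hp⟩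
    exact ⟨p, hconv.mem_hsub_of_littleO hp⟩
end
end

section
/- Let Ω ⊆ ℍ be open and H-convex, u : Ω → ℝ be H-convex, g ∈ Ω, and p ∈ ℝ². Then p ∈ ∂_H u(g) if and only if for every v ∈ ℝ² the one-sided limit u'(g;v) = lim_{λ→0⁺} (u(g·exp(λv)) − u(g))/λ exists in ℝ and satisfies u'(g;v) ≥ ⟨p, v⟩. -/
noncomputable section

open Filter Topology Set
open scoped ENNReal

lemma hmul_hexp_mem_hplane (g : Hgrp) (v : ℝ × ℝ) (a b : ℝ) :
    hmul g (hexp (b • v)) ∈ hplane (hmul g (hexp (a • v))) := by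
  simp only [hplane, hmul, hexp, mem_ofPred_eq, Prod.smul_fst, Prod.smul_snd, smul_eq_mul]
  ring

/-- Heisenberg interpolation between two points of a horizontal line is affine interpolation
of the parameter. -/
lemma hmul_hdil_hmul_hexp (g : Hgrp) (v : ℝ × ℝ) (a b l : ℝ) :
    hmul (hmul g (hexp (a • v)))
      (hdil l (hmul (hinv (hmul g (hexp (a • v)))) (hmul g (hexp (b • v))))) =
      hmul g (hexp ((a + l * (b - a)) • v)) := by
  simp only [hmul, hexp, hdil, hinv, Prod.smul_fst, Prod.smul_snd, smul_eq_mul, Prod.mk.injEq]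
  refine ⟨by ring, by ring, by ring⟩

lemma hmul_hexp_zero_smul (g : Hgrp) (v : ℝ × ℝ) : hmul g (hexp ((0 : ℝ) • v)) = g := by
  simp [hmul, hexp]

lemma hmul_hexp_xi1_sub {g g' : Hgrp} (h : g' ∈ hplane g) :
    hmul g (hexp ((1 : ℝ) • (xi1 g' - xi1 g))) = g' := by
  simp only [hplane, mem_ofPred_eq] at h
  ext
  · simp [hmul, hexp, xi1]
  · simp [hmul, hexp, xi1]
  · simp only [hmul, hexp, xi1, one_smul, Prod.fst_sub, Prod.snd_sub, h]
    ring

/-- An H-convex function is convex along horizontal lines. -/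
lemma HConvexOn.convexOn_line {Ω : Set Hgrp} {u : Hgrp → ℝ} (hu : HConvexOn Ω u)
    (hΩ : HConvexSet Ω) (g : Hgrp) (v : ℝ × ℝ) :
    ConvexOn ℝ {l : ℝ | hmul g (hexp (l • v)) ∈ Ω} (fun l : ℝ => u (hmul g (hexp (l • v)))) := by
  have key : ∀ a b s t : ℝ, s + t = 1 → s • a + t • b = a + t * (b - a) := by
    intro a b s t h
    obtain rfl : s = 1 - t := by linarith
    simp only [smul_eq_mul]
    ring
  refine ⟨fun a ha b hb s t hs ht hst => ?_, fun a ha b hb s t hs ht hst => ?_⟩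
  · rw [mem_ofPred_eq, key a b s t hst, ← hmul_hdil_hmul_hexp]
    exact hΩ _ ha _ ⟨hmul_hexp_mem_hplane g v a b, hb⟩ t ⟨ht, by linarith⟩
  · have h := hu _ ha _ ⟨hmul_hexp_mem_hplane g v a b, hb⟩ t ⟨ht, by linarith⟩
    rw [hmul_hdil_hmul_hexp] at h
    simp only [key a b s t hst]
    obtain rfl : s = 1 - t := by linarith
    simp only [smul_eq_mul]
    linarith

lemma continuous_hmul_hexp_smul (g : Hgrp) (v : ℝ × ℝ) :
    Continuous fun l : ℝ => hmul g (hexp (l • v)) := by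
  simp only [hmul, hexp]
  fun_prop

/-- One-sided horizontal directional derivatives of an H-convex function exist. -/
lemma HConvexOn.exists_tendsto_quotient {Ω : Set Hgrp} {u : Hgrp → ℝ} (hu : HConvexOn Ω u)
    (hΩo : IsOpen Ω) (hΩ : HConvexSet Ω) {g : Hgrp} (hg : g ∈ Ω) (v : ℝ × ℝ) :
    ∃ L : ℝ, Tendsto (fun l : ℝ => (u (hmul g (hexp (l • v))) - u g) / l) (𝓝[>] 0) (𝓝 L) := by
  have hmem : (0 : ℝ) ∈ interior {l : ℝ | hmul g (hexp (l • v)) ∈ Ω} := by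
    refine mem_interior_iff_mem_nhds.2
      ((continuous_hmul_hexp_smul g v).continuousAt.eventually_mem (hΩo.mem_nhds ?_))
    rwa [hmul_hexp_zero_smul]
  have h := (hu.convexOn_line hΩ g v).hasDerivWithinAt_rightDeriv_of_mem_interior hmem
  rw [hasDerivWithinAt_iff_tendsto_slope' (by simp)] at h
  refine ⟨_, h.congr fun l => ?_⟩
  rw [slope_def_field, hmul_hexp_zero_smul, sub_zero]

/-- characterization of H-subgradients of an H-convex function via the
one-sided directional derivatives `u'(g; v)`. -/
theorem stmt1 (Ω : Set Hgrp) (hΩo : IsOpen Ω) (hΩc : HConvexSet Ω)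
    (u : Hgrp → ℝ) (hu : HConvexOn Ω u) (g : Hgrp) (hg : g ∈ Ω) (p : ℝ × ℝ) :
    p ∈ hsub Ω u g ↔
      ∀ v : ℝ × ℝ, ∃ L : ℝ,
        Filter.Tendsto (fun l : ℝ => (u (hmul g (hexp (l • v))) - u g) / l)
          (nhdsWithin 0 (Set.Ioi 0)) (nhds L) ∧ dot p v ≤ L := by
  constructor
  · intro hp v
    obtain ⟨L, hL⟩ := hu.exists_tendsto_quotient hΩo hΩc hg v
    refine ⟨L, hL, ge_of_tendsto hL ?_⟩
    have hmem : ∀ᶠ l : ℝ in 𝓝[>] 0, hmul g (hexp (l • v)) ∈ Ω := by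
      refine nhdsWithin_le_nhds ((continuous_hmul_hexp_smul g v).continuousAt.eventually_mem
        (hΩo.mem_nhds ?_))
      rwa [hmul_hexp_zero_smul]
    filter_upwards [hmem, self_mem_nhdsWithin] with l hl hl0
    have hplane_l := hmul_hexp_mem_hplane g v 0 l
    rw [hmul_hexp_zero_smul] at hplane_l
    have h := hp _ ⟨hplane_l, hl⟩
    have hdot : dot p (xi1 (hmul g (hexp (l • v))) - xi1 g) = dot p v * l := by
      simp only [dot, xi1, hmul, hexp, Prod.fst_sub, Prod.snd_sub, Prod.smul_fst, Prod.smul_snd,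
        smul_eq_mul]
      ring
    rw [hdot] at h
    rw [le_div_iff₀ hl0]
    linarith
  · rintro h g' ⟨hg', hg'Ω⟩
    obtain ⟨L, hL, hpL⟩ := h (xi1 g' - xi1 g)
    have hle : L ≤ u g' - u g := by
      refine le_of_tendsto hL ?_
      filter_upwards [Ioc_mem_nhdsGT (zero_lt_one' ℝ)] with l hl
      have hconv := hu g hg g' ⟨hg', hg'Ω⟩ l ⟨hl.1.le, hl.2⟩
      have hline := hmul_hdil_hmul_hexp g (xi1 g' - xi1 g) 0 1 l
      rw [hmul_hexp_zero_smul, hmul_hexp_xi1_sub hg'] at hline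
      simp only [zero_add, sub_zero, mul_one] at hline
      rw [hline] at hconv
      rw [div_le_iff₀ hl.1]
      linarith
    linarith
end
end

section
/- Let Ω ⊆ ℍ be open and H-convex and u : Ω → ℝ be H-convex. If u is Pansu differentiable at g ∈ Ω with horizontal differential p ∈ ℝ² (that is, (u(g·h) − u(g) − ⟨p, ξ₁(h)⟩)/‖h‖_ℍ → 0 as ‖h‖_ℍ → 0), then p ∈ ∂_H u(g). -/
noncomputable section

open Filter Topology Set
open scoped ENNReal

/-- The Korányi gauge is homogeneous of degree one under the dilations. -/
theorem kgauge_hdil {l : ℝ} (hl : 0 ≤ l) (g : Hgrp) : kgauge (hdil l g) = l * kgauge g := by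
  have h : ((l * g.1) ^ 2 + (l * g.2.1) ^ 2) ^ 2 + (l ^ 2 * g.2.2) ^ 2
      = l ^ 4 * ((g.1 ^ 2 + g.2.1 ^ 2) ^ 2 + g.2.2 ^ 2) := by ring
  have hroot : (l ^ 4) ^ ((1:ℝ) / 4) = l := by
    simpa using Real.pow_rpow_inv_natCast hl (n := 4) (by norm_num)
  simp only [kgauge, hdil]
  rw [h, Real.mul_rpow (by positivity) (by positivity), hroot]

theorem kgauge_nonneg (g : Hgrp) : 0 ≤ kgauge g :=
  Real.rpow_nonneg (by positivity) _

theorem xi1_hmul_hinv (g g' : Hgrp) : xi1 (hmul (hinv g) g') = xi1 g' - xi1 g := by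
  simp only [xi1, hmul, hinv, Prod.mk_sub_mk]
  ext <;> simp only <;> ring

theorem dot_xi1_hdil (p : ℝ × ℝ) (l : ℝ) (g : Hgrp) :
    dot p (xi1 (hdil l g)) = l * dot p (xi1 g) := by
  simp only [dot, xi1, hdil]
  ring

/-- if an H-convex function `u` is Pansu differentiable at `g` with
horizontal differential `p`, then `p ∈ ∂_H u(g)`. -/
theorem stmt2 (Ω : Set Hgrp) (hΩo : IsOpen Ω) (hΩc : HConvexSet Ω)
    (u : Hgrp → ℝ) (hu : HConvexOn Ω u) (g : Hgrp) (hg : g ∈ Ω) (p : ℝ × ℝ)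
    (hpansu : ∀ ε > (0:ℝ), ∃ δ > (0:ℝ), ∀ h : Hgrp, kgauge h < δ →
      |u (hmul g h) - u g - dot p (xi1 h)| ≤ ε * kgauge h) :
    p ∈ hsub Ω u g := by
  intro g' hg'
  set w := hmul (hinv g) g' with hw
  rw [← xi1_hmul_hinv, ← hw, ge_iff_le]
  refine le_of_forall_pos_le_add fun η hη => ?_
  have hN := kgauge_nonneg w
  obtain ⟨δ, hδ, hδu⟩ := hpansu (η / (kgauge w + 1)) (by positivity)
  obtain ⟨l, hl, hlδ, hl1⟩ : ∃ l : ℝ, 0 < l ∧ l * (kgauge w + 1) ≤ δ ∧ l ≤ 1 :=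
    ⟨min (δ / (kgauge w + 1)) 1, by positivity,
      (le_div_iff₀ (by positivity)).1 (min_le_left _ _), min_le_right _ _⟩
  have hlow := hδu (hdil l w) (by rw [kgauge_hdil hl.le]; linarith)
  rw [kgauge_hdil hl.le, dot_xi1_hdil] at hlow
  have hlow := (abs_le.1 hlow).1
  have hconv := hu g hg g' hg' l ⟨hl.le, hl1⟩
  rw [← hw] at hconv
  have hε : η / (kgauge w + 1) * kgauge w ≤ η := by
    rw [div_mul_eq_mul_div, div_le_iff₀ (by positivity)]
    linarith
  have hεl := mul_le_mul_of_nonneg_left hε hl.le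
  refine le_of_mul_le_mul_left ?_ hl
  linarith
end
end

section
/- Let Ω ⊆ ℍ be open and u : Ω → ℝ be continuous. Then the H-normal map ∂_H u has closed graph: if (gₙ) ⊆ Ω with gₙ → g₀ ∈ Ω, pₙ ∈ ∂_H u(gₙ) for every n, and pₙ → p in ℝ², then p ∈ ∂_H u(g₀). -/
noncomputable section

open Filter Topology Set
open scoped ENNReal

/-- the H-normal map of a continuous function has closed graph. -/
theorem stmt3 (Ω : Set Hgrp) (hΩo : IsOpen Ω) (u : Hgrp → ℝ)
    (hu : ContinuousOn u Ω) (g : ℕ → Hgrp) (g0 : Hgrp)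
    (hgmem : ∀ n, g n ∈ Ω) (hg0 : g0 ∈ Ω)
    (hgl : Filter.Tendsto g Filter.atTop (nhds g0))
    (p : ℕ → ℝ × ℝ) (hp : ∀ n, p n ∈ hsub Ω u (g n)) (p0 : ℝ × ℝ)
    (hpl : Filter.Tendsto p Filter.atTop (nhds p0)) :
    p0 ∈ hsub Ω u g0 := by
  rintro q ⟨hq, hqΩ⟩
  have hplane_q : q.2.2 = g0.2.2 + 2 * g0.2.1 * q.1 - 2 * g0.1 * q.2.1 := hq
  have hx : Tendsto (fun n => (g n).1) atTop (𝓝 g0.1) := hgl.fst_nhds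
  have hy : Tendsto (fun n => (g n).2.1) atTop (𝓝 g0.2.1) := hgl.snd_nhds.fst_nhds
  have ht : Tendsto (fun n => (g n).2.2) atTop (𝓝 g0.2.2) := hgl.snd_nhds.snd_nhds
  -- The vertical projection of `q` to the horizontal plane through `g n`.
  let r : ℕ → Hgrp := fun n =>
    (q.1, q.2.1, (g n).2.2 + 2 * (g n).2.1 * q.1 - 2 * (g n).1 * q.2.1)
  have hr : Tendsto r atTop (𝓝 q) := by
    have ht' : Tendsto (fun n => (g n).2.2 + 2 * (g n).2.1 * q.1 - 2 * (g n).1 * q.2.1)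
        atTop (𝓝 q.2.2) := by
      rw [hplane_q]
      exact (ht.add ((hy.const_mul 2).mul_const q.1)).sub ((hx.const_mul 2).mul_const q.2.1)
    exact tendsto_const_nhds.prodMk_nhds (tendsto_const_nhds.prodMk_nhds ht')
  have hur : Tendsto (fun n => u (r n)) atTop (𝓝 (u q)) :=
    (hu.continuousAt (hΩo.mem_nhds hqΩ)).tendsto.comp hr
  have hug : Tendsto (fun n => u (g n)) atTop (𝓝 (u g0)) :=
    (hu.continuousAt (hΩo.mem_nhds hg0)).tendsto.comp hgl
  have hdot : Tendsto (fun n => dot (p n) (xi1 (r n) - xi1 (g n))) atTop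
      (𝓝 (dot p0 (xi1 q - xi1 g0))) :=
    (hpl.fst_nhds.mul (tendsto_const_nhds.sub hx)).add
      (hpl.snd_nhds.mul (tendsto_const_nhds.sub hy))
  refine le_of_tendsto_of_tendsto (hug.add hdot) hur ?_
  filter_upwards [hr.eventually (hΩo.mem_nhds hqΩ)] with n hn
  exact hp n (r n) ⟨rfl, hn⟩
end
end

section
/- Let Ω ⊆ ℍ be open and H-convex and u : Ω → ℝ. Then u is H-convex if and only if ∂_H u(g) ≠ ∅ for every g ∈ Ω. -/
noncomputable section

open Filter Topology Set
open scoped ENNReal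

/-- Convexity of `w` along horizontal segments with end points in the box `[-R, R]³`. -/
def HBoxConvex (R : ℝ) (w : ℝ → ℝ → ℝ → ℝ) : Prop :=
  ∀ x y t x' y' t' l : ℝ, |x| ≤ R → |y| ≤ R → |t| ≤ R → |x'| ≤ R → |y'| ≤ R → |t'| ≤ R →
    t' = t + 2 * y * x' - 2 * x * y' → 0 ≤ l → l ≤ 1 →
    w (x + l * (x' - x)) (y + l * (y' - y)) (t + l * (t' - t)) ≤
      w x y t + l * (w x' y' t' - w x y t)

lemma HBoxConvex.mono {R R' : ℝ} {w : ℝ → ℝ → ℝ → ℝ} (hw : HBoxConvex R w) (h : R' ≤ R) :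
    HBoxConvex R' w := fun x y t x' y' t' l h1 h2 h3 h4 h5 h6 =>
  hw x y t x' y' t' l (h1.trans h) (h2.trans h) (h3.trans h) (h4.trans h) (h5.trans h) (h6.trans h)

/-- Convexity along the rays of the plane `t = 0` issuing from the origin. -/
lemma HBoxConvex.ray {R : ℝ} {w : ℝ → ℝ → ℝ → ℝ} (hw : HBoxConvex R w) {x y l : ℝ}
    (hx : |x| ≤ R) (hy : |y| ≤ R) (hl : 0 ≤ l) (hl' : l ≤ 1) :
    w (l * x) (l * y) 0 ≤ w 0 0 0 + l * (w x y 0 - w 0 0 0) := by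
  have hR : |(0 : ℝ)| ≤ R := by simpa using (abs_nonneg x).trans hx
  simpa using hw 0 0 0 x y 0 l hR hR hR hx hy hR (by simp) hl hl'

/-- The midpoint inequality at the origin. -/
lemma HBoxConvex.midpoint {R : ℝ} {w : ℝ → ℝ → ℝ → ℝ} (hw : HBoxConvex R w) {x y : ℝ}
    (hx : |x| ≤ R) (hy : |y| ≤ R) : 2 * w 0 0 0 ≤ w x y 0 + w (-x) (-y) 0 := by
  have hR : |(0 : ℝ)| ≤ R := by simpa using (abs_nonneg x).trans hx
  have := hw x y 0 (-x) (-y) 0 (1 / 2) hx hy hR (by rwa [abs_neg]) (by rwa [abs_neg]) hR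
    (by ring) (by norm_num) (by norm_num)
  ring_nf at this ⊢
  linarith

/-- Difference quotients along horizontal rays converge. -/
lemma HBoxConvex.exists_tendsto_quotient {R : ℝ} {w : ℝ → ℝ → ℝ → ℝ} (hR : 0 < R)
    (hw : HBoxConvex R w) (v : ℝ × ℝ) :
    ∃ d : ℝ, Tendsto (fun s : ℝ => (w (s * v.1) (s * v.2) 0 - w 0 0 0) / s) (𝓝[>] 0) (𝓝 d) := by
  obtain ⟨a, b⟩ := v
  set r : ℝ := R / (|a| + |b| + 1) with hr
  have hden : 0 < |a| + |b| + 1 := by positivity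
  have hr0 : 0 < r := by positivity
  have hrR : r * (|a| + |b| + 1) = R := by rw [hr]; field_simp
  have hin : ∀ s, |s| ≤ r → |s * a| ≤ R ∧ |s * b| ≤ R := fun s hs => by
    have h1 := mul_le_mul_of_nonneg_right hs (abs_nonneg a)
    have h2 := mul_le_mul_of_nonneg_right hs (abs_nonneg b)
    have h3 := mul_nonneg hr0.le (abs_nonneg a)
    have h4 := mul_nonneg hr0.le (abs_nonneg b)
    rw [abs_mul, abs_mul]
    constructor <;> nlinarith
  have hz : |(0 : ℝ)| ≤ R := by simpa using hR.le
  refine ⟨_, MonotoneOn.tendsto_nhdsWithin_Ioo_right (y := r) (nonempty_Ioo.2 hr0) ?_ ?_⟩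
  · rintro s ⟨hs0, hsr⟩ s' ⟨hs0', hsr'⟩ hss
    obtain ⟨h1, h2⟩ := hin s' (by rw [abs_of_pos hs0']; exact hsr'.le)
    have h := hw.ray h1 h2 (l := s / s') (by positivity) ((div_le_one hs0').2 hss)
    have e1 : s / s' * (s' * a) = s * a := by field_simp
    have e2 : s / s' * (s' * b) = s * b := by field_simp
    rw [e1, e2] at h
    change (_ - _) / s ≤ (_ - _) / s'
    rw [div_le_iff₀ hs0]
    calc _ ≤ s / s' * (w (s' * a) (s' * b) 0 - w 0 0 0) := by linarith
      _ = _ := by ring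
  · refine ⟨(w 0 0 0 - w (-r * a) (-r * b) 0) / r, ?_⟩
    rintro _ ⟨s, ⟨hs0, hsr⟩, rfl⟩
    obtain ⟨h1, h2⟩ := hin s (by rw [abs_of_pos hs0]; exact hsr.le)
    obtain ⟨h3, h4⟩ := hin (-r) (by rw [abs_neg, abs_of_pos hr0])
    have h := hw (-r * a) (-r * b) 0 (s * a) (s * b) 0 (r / (r + s)) h3 h4 hz h1 h2 hz (by ring)
      (by positivity) ((div_le_one (by positivity)).2 (by linarith))
    have e1 : ∀ c, -r * c + r / (r + s) * (s * c - -r * c) = 0 := fun c => by field_simp; ring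
    have e2 : (0 : ℝ) + r / (r + s) * (0 - 0) = 0 := by ring
    rw [e1, e1, e2, ← sub_le_iff_le_add', div_mul_eq_mul_div, le_div_iff₀ (by positivity)] at h
    change _ ≤ (_ - _) / s
    rw [div_le_div_iff₀ hr0 hs0]
    linarith

/-- If `w` is H-convex and Lipschitz in the vertical direction, its directional derivative
at the origin is sublinear, hence `w` has a horizontal subgradient there. -/
lemma HBoxConvex.exists_subgradient_of_vertical_bound {R K : ℝ} {w : ℝ → ℝ → ℝ → ℝ} (hR : 0 < R)
    (hw : HBoxConvex R w)
    (hK : ∀ x y t, |x| ≤ R → |y| ≤ R → |t| ≤ R → w x y t ≤ w x y 0 + K * |t|) :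
    ∃ p : ℝ × ℝ, ∀ x y, |x| ≤ R → |y| ≤ R → w 0 0 0 + (p.1 * x + p.2 * y) ≤ w x y 0 := by
  choose N hN using hw.exists_tendsto_quotient hR
  have tendsto_scale : ∀ c : ℝ, 0 < c → Tendsto (fun s : ℝ => c * s) (𝓝[>] 0) (𝓝[>] 0) := fun c hc => by
    refine tendsto_nhdsWithin_iff.2 ⟨?_, ?_⟩
    · have : Tendsto (fun s : ℝ => c * s) (𝓝 0) (𝓝 (c * 0)) := by
        exact (continuous_const_mul c).tendsto 0
      rw [mul_zero] at this
      exact this.mono_left nhdsWithin_le_nhds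
    · filter_upwards [self_mem_nhdsWithin] with s hs
      exact mul_pos hc hs
  have hom : ∀ c : ℝ, 0 < c → ∀ v, N (c • v) = c * N v := fun c hc v => by
    refine tendsto_nhds_unique (hN (c • v)) ?_
    refine Tendsto.congr' ?_ (((hN v).comp (tendsto_scale c hc)).const_mul c)
    filter_upwards [self_mem_nhdsWithin] with s hs
    have hs : (0 : ℝ) < s := hs
    simp only [Function.comp, Prod.smul_fst, Prod.smul_snd, smul_eq_mul]
    rw [show c * s * v.1 = s * (c * v.1) by ring, show c * s * v.2 = s * (c * v.2) by ring]
    field_simp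
  have hsmall : ∀ c : ℝ, ∀ᶠ s : ℝ in 𝓝[>] 0, |s * c| ≤ R := fun c => by
    have : Tendsto (fun s : ℝ => |s * c|) (𝓝 0) (𝓝 (|0 * c|)) := by
      exact (by fun_prop : Continuous fun s : ℝ => |s * c|).tendsto 0
    rw [zero_mul, abs_zero] at this
    exact (this.mono_left nhdsWithin_le_nhds).eventually_le_const hR
  have add : ∀ v v', N (v + v') ≤ N v + N v' := fun v v' => by
    set c : ℝ := 4 * (v.1 * v'.2 - v.2 * v'.1) with hc
    have hlim : Tendsto (fun s : ℝ =>
        (w (2 * s * v.1) (2 * s * v.2) 0 - w 0 0 0) / (2 * s) +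
        (w (2 * s * v'.1) (2 * s * v'.2) 0 - w 0 0 0) / (2 * s) + s * (K * |c|))
        (𝓝[>] 0) (𝓝 (N v + N v' + 0 * (K * |c|))) := by
      refine (((hN v).comp (tendsto_scale 2 two_pos)).add ((hN v').comp (tendsto_scale 2 two_pos))).add ?_
      exact ((tendsto_id (α := ℝ) (x := 𝓝 0)).mono_left nhdsWithin_le_nhds).mul_const _
    rw [zero_mul, add_zero] at hlim
    refine le_of_tendsto_of_tendsto (hN (v + v')) hlim ?_
    filter_upwards [self_mem_nhdsWithin, hsmall (2 * v.1), hsmall (2 * v.2), hsmall (2 * v'.1),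
      hsmall (2 * v'.2), hsmall c, Ioo_mem_nhdsGT (zero_lt_one' ℝ)] with s hs h1 h2 h3 h4 h5 h6
    have hs : (0 : ℝ) < s := hs
    have ht : |s * s * c| ≤ R := by
      rw [mul_assoc, abs_mul, abs_of_pos hs]
      nlinarith [abs_nonneg (s * c), h6.2]
    have ht' : |-(s * s * c)| ≤ R := by rwa [abs_neg]
    have e : ∀ a, 2 * s * a = s * (2 * a) := fun a => by ring
    have key := hw (s * (2 * v.1)) (s * (2 * v.2)) (s * s * c) (s * (2 * v'.1)) (s * (2 * v'.2))
      (-(s * s * c)) (1 / 2) h1 h2 ht h3 h4 ht' (by rw [hc]; ring) (by norm_num) (by norm_num)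
    have k1 := hK _ _ _ h1 h2 ht
    have k2 := hK _ _ _ h3 h4 ht'
    rw [abs_neg] at k2
    have e3 : |s * s * c| = s * s * |c| := by rw [abs_mul, abs_of_pos (mul_pos hs hs)]
    rw [e3] at k1 k2
    rw [show s * (2 * v.1) + 1 / 2 * (s * (2 * v'.1) - s * (2 * v.1)) = s * (v + v').1 by
        rw [Prod.fst_add]; ring,
      show s * (2 * v.2) + 1 / 2 * (s * (2 * v'.2) - s * (2 * v.2)) = s * (v + v').2 by
        rw [Prod.snd_add]; ring,
      show s * s * c + 1 / 2 * (-(s * s * c) - s * s * c) = 0 by ring] at key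
    rw [e, e, e, e, div_le_iff₀ hs]
    have : ((w (s * (2 * v.1)) (s * (2 * v.2)) 0 - w 0 0 0) / (2 * s) +
        (w (s * (2 * v'.1)) (s * (2 * v'.2)) 0 - w 0 0 0) / (2 * s) + s * (K * |c|)) * s =
        (w (s * (2 * v.1)) (s * (2 * v.2)) 0 - w 0 0 0) / 2 +
        (w (s * (2 * v'.1)) (s * (2 * v'.2)) 0 - w 0 0 0) / 2 + K * (s * s * |c|) := by
      field_simp
    rw [this]
    linarith
  obtain ⟨g, -, hg⟩ := exists_extension_of_le_sublinear (⊥ : (ℝ × ℝ) →ₗ.[ℝ] ℝ) N hom add (by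
    rintro ⟨v, hv⟩
    have hv0 : v = 0 := (Submodule.mem_bot ℝ).1 hv
    subst hv0
    have h0 := hom 2 two_pos 0
    rw [smul_zero] at h0
    have h1 : N 0 = 0 := by linarith
    have h2 : (⟨0, hv⟩ : (⊥ : (ℝ × ℝ) →ₗ.[ℝ] ℝ).domain) = 0 := rfl
    rw [h2, LinearPMap.map_zero]
    exact h1.ge)
  refine ⟨(g (1, 0), g (0, 1)), fun x y hx hy => ?_⟩
  have hle : N (x, y) ≤ w x y 0 - w 0 0 0 := by
    refine le_of_tendsto (hN (x, y)) ?_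
    filter_upwards [Ioo_mem_nhdsGT (zero_lt_one' ℝ)] with s hs
    rw [div_le_iff₀ hs.1]
    have := hw.ray hx hy hs.1.le hs.2.le
    linarith
  have hgv : g (x, y) = g (1, 0) * x + g (0, 1) * y := by
    have : ((x, y) : ℝ × ℝ) = x • (1, 0) + y • (0, 1) := by simp
    rw [this, map_add, map_smul, map_smul, smul_eq_mul, smul_eq_mul]
    ring
  have := hg (x, y)
  linarith

/-- Sup-convolution of `w` in the vertical variable, over shifts of size at most `δ`. -/
def vertSup (δ n : ℝ) (w : ℝ → ℝ → ℝ → ℝ) (x y t : ℝ) : ℝ :=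
  sSup ((fun τ => w x y (t + τ) - n * |τ|) '' Icc (-δ) δ)

lemma vertSup_le {δ n a : ℝ} {w : ℝ → ℝ → ℝ → ℝ} {x y t : ℝ} (hδ : 0 ≤ δ)
    (h : ∀ τ, |τ| ≤ δ → w x y (t + τ) - n * |τ| ≤ a) : vertSup δ n w x y t ≤ a := by
  refine csSup_le ((nonempty_Icc.2 (by linarith)).image _) ?_
  rintro _ ⟨τ, hτ, rfl⟩
  exact h τ (abs_le.2 hτ)

lemma le_vertSup {R n M : ℝ} {w : ℝ → ℝ → ℝ → ℝ} (hn : 0 ≤ n)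
    (hM : ∀ x y t, |x| ≤ R → |y| ≤ R → |t| ≤ R → w x y t ≤ M) {x y t τ : ℝ} (hx : |x| ≤ R)
    (hy : |y| ≤ R) (ht : |t| ≤ R / 2) (hτ : |τ| ≤ R / 2) :
    w x y (t + τ) - n * |τ| ≤ vertSup (R / 2) n w x y t := by
  refine le_csSup ⟨M, ?_⟩ ⟨τ, abs_le.1 hτ, rfl⟩
  rintro _ ⟨σ, hσ, rfl⟩
  have h1 := hM x y (t + σ) hx hy ((abs_add_le _ _).trans (by linarith [abs_le.2 hσ]))
  have h2 := mul_nonneg hn (abs_nonneg σ)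
  change _ - _ ≤ M
  linarith

lemma HBoxConvex.supConvolution {R n M : ℝ} {w : ℝ → ℝ → ℝ → ℝ} (hw : HBoxConvex R w) (hR : 0 < R)
    (hn : 0 ≤ n) (hM : ∀ x y t, |x| ≤ R → |y| ≤ R → |t| ≤ R → w x y t ≤ M) :
    HBoxConvex (R / 2) (vertSup (R / 2) n w) := by
  intro x y t x' y' t' l hx hy ht hx' hy' ht' h hl hl'
  have hRR : R / 2 ≤ R := by linarith
  refine vertSup_le (by linarith) fun τ hτ => ?_
  have k1 := le_vertSup hn hM (hx.trans hRR) (hy.trans hRR) ht hτ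
  have k2 := le_vertSup hn hM (hx'.trans hRR) (hy'.trans hRR) ht' hτ
  have k := hw x y (t + τ) x' y' (t' + τ) l (hx.trans hRR) (hy.trans hRR)
    ((abs_add_le _ _).trans (by linarith)) (hx'.trans hRR) (hy'.trans hRR)
    ((abs_add_le _ _).trans (by linarith)) (by linarith) hl hl'
  rw [show t + τ + l * (t' + τ - (t + τ)) = t + l * (t' - t) + τ by ring] at k
  have k3 := mul_le_mul_of_nonneg_left k2 hl
  have k4 := mul_le_mul_of_nonneg_left k1 (sub_nonneg.2 hl')
  linarith

/-- An H-convex function which is bounded above and vertically upper semicontinuous on the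
plane `t = 0` has a horizontal subgradient at the origin. -/
lemma HBoxConvex.exists_subgradient_of_vertical_usc {R M : ℝ} {w : ℝ → ℝ → ℝ → ℝ} (hR : 0 < R)
    (hw : HBoxConvex R w) (hM : ∀ x y t, |x| ≤ R → |y| ≤ R → |t| ≤ R → w x y t ≤ M)
    (husc : ∀ x y, |x| ≤ R → |y| ≤ R → ∀ η > 0, ∃ δ > 0, ∀ τ, |τ| ≤ δ →
      w x y τ ≤ w x y 0 + η) :
    ∃ p : ℝ × ℝ, ∀ x y, |x| ≤ R / 4 → |y| ≤ R / 4 →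
      w 0 0 0 + (p.1 * x + p.2 * y) ≤ w x y 0 := by
  have hz : |(0 : ℝ)| ≤ R := by simpa using hR.le
  have hz2 : |(0 : ℝ)| ≤ R / 2 := by rw [abs_zero]; linarith
  have hM0 := hM 0 0 0 hz hz hz
  set n₀ : ℝ := 8 * (M - w 0 0 0) / R with hn₀
  have hn₀R : n₀ * R = 8 * (M - w 0 0 0) := by rw [hn₀]; field_simp
  have hn₀0 : 0 ≤ n₀ := div_nonneg (by linarith) hR.le
  have hnk : ∀ k : ℕ, 0 ≤ n₀ + k := fun k => by positivity
  have hlow : ∀ x y, |x| ≤ R → |y| ≤ R → 2 * w 0 0 0 - M ≤ w x y 0 := fun x y hx hy => by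
    have h1 := hw.midpoint hx hy
    have h2 := hM (-x) (-y) 0 (by rwa [abs_neg]) (by rwa [abs_neg]) hz
    linarith
  have hself : ∀ (k : ℕ) x y, |x| ≤ R → |y| ≤ R →
      w x y 0 ≤ vertSup (R / 2) (n₀ + k) w x y 0 := fun k x y hx hy => by
    simpa using le_vertSup (hnk k) hM hx hy hz2 hz2
  set S : ℕ → Set (ℝ × ℝ) := fun k => {p | ∀ x y, |x| ≤ R / 4 → |y| ≤ R / 4 →
    w 0 0 0 + (p.1 * x + p.2 * y) ≤ vertSup (R / 2) (n₀ + k) w x y 0} with hS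
  have hSne : ∀ k, (S k).Nonempty := fun k => by
    obtain ⟨p, hp⟩ := HBoxConvex.exists_subgradient_of_vertical_bound (K := n₀ + k)
      (by linarith : 0 < R / 4) ((hw.supConvolution hR (hnk k) hM).mono (by linarith)) (by
        intro x y t hx hy ht
        have hx : |x| ≤ R := by linarith
        have hy : |y| ≤ R := by linarith
        refine vertSup_le (by linarith) fun τ hτ => ?_
        by_cases hc : |t + τ| ≤ R / 2
        · have k1 := le_vertSup (hnk k) hM hx hy hz2 hc
          have k2 : |t + τ| ≤ |t| + |τ| := abs_add_le _ _
          rw [zero_add] at k1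
          have k3 := mul_le_mul_of_nonneg_left k2 (hnk k)
          linarith
        · have k2 : |t + τ| ≤ |t| + |τ| := abs_add_le _ _
          have k3 : R / 4 ≤ |τ| := by linarith
          have k4 := mul_le_mul_of_nonneg_left k3 (hnk k)
          have k5 : 0 ≤ (k : ℝ) * R := by positivity
          have k6 := hM x y (t + τ) hx hy (k2.trans (by linarith))
          have k7 := hlow x y hx hy
          have k8 := hself k x y hx hy
          have k9 := mul_nonneg (hnk k) (abs_nonneg t)
          linarith)
    refine ⟨p, fun x y hx hy => (hp x y hx hy).trans' ?_⟩
    have := hself k 0 0 hz hz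
    linarith
  have hSanti : ∀ k, S (k + 1) ⊆ S k := fun k p hp x y hx hy => by
    refine (hp x y hx hy).trans ?_
    refine vertSup_le (by linarith) fun τ hτ => ?_
    have k1 := le_vertSup (hnk k) hM (x := x) (y := y) (by linarith) (by linarith) hz2 hτ
    have k2 := abs_nonneg τ
    push_cast
    linarith
  have hSclosed : ∀ k, IsClosed (S k) := fun k => by
    simp only [hS, ofPred_forall]
    refine isClosed_iInter fun x => isClosed_iInter fun y => isClosed_iInter fun _ =>
      isClosed_iInter fun _ => isClosed_le (by fun_prop) continuous_const
  have hScomp : IsCompact (S 0) := by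
    refine (isCompact_Icc (a := ((-n₀, -n₀) : ℝ × ℝ)) (b := (n₀, n₀))).of_isClosed_subset
      (hSclosed 0) fun p hp => ?_
    have hup : ∀ x y, |x| ≤ R / 4 → |y| ≤ R / 4 → p.1 * x + p.2 * y ≤ M - w 0 0 0 :=
      fun x y hx hy => by
        have h1 := hp x y hx hy
        have h2 : vertSup (R / 2) (n₀ + (0 : ℕ)) w x y 0 ≤ M :=
          vertSup_le (by linarith) fun τ hτ => by
            have h3 := hM x y (0 + τ) (by linarith) (by linarith) (by rw [zero_add]; linarith)
            have h4 := mul_nonneg (hnk 0) (abs_nonneg τ)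
            linarith
        linarith
    have r1 : |R / 4| ≤ R / 4 := (abs_of_pos (by linarith)).le
    have r2 : |-(R / 4)| ≤ R / 4 := by rwa [abs_neg]
    have r3 : |(0 : ℝ)| ≤ R / 4 := by rw [abs_zero]; linarith
    have q1 := hup _ _ r1 r3
    have q2 := hup _ _ r2 r3
    have q3 := hup _ _ r3 r1
    have q4 := hup _ _ r3 r2
    refine ⟨⟨?_, ?_⟩, ⟨?_, ?_⟩⟩ <;> dsimp only <;> nlinarith
  obtain ⟨p, hp⟩ := IsCompact.nonempty_iInter_of_sequence_nonempty_isCompact_isClosed S hSanti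
    hSne hScomp hSclosed
  rw [mem_iInter] at hp
  refine ⟨p, fun x y hx hy => le_of_forall_pos_le_add fun η hη => ?_⟩
  have hx' : |x| ≤ R := by linarith
  have hy' : |y| ≤ R := by linarith
  obtain ⟨δ, hδ, hτδ⟩ := husc x y hx' hy' η hη
  obtain ⟨k, hk⟩ := exists_nat_gt ((M - w x y 0) / δ)
  rw [div_lt_iff₀ hδ] at hk
  refine (hp k x y hx hy).trans (vertSup_le (by linarith) fun τ hτ => ?_)
  rw [zero_add]
  have k1 := mul_nonneg hn₀0 (abs_nonneg τ)
  have k2 : 0 ≤ (k : ℝ) * |τ| := by positivity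
  rcases le_total |τ| δ with h | h
  · have := hτδ τ h
    linarith
  · have h1 := hM x y τ hx' hy' (by linarith)
    have h2 := mul_le_mul_of_nonneg_left h (Nat.cast_nonneg (α := ℝ) k)
    linarith

/-- A point of a vertical line is the midpoint of a horizontal segment whose end points slide
along two horizontal segments. -/
lemma HBoxConvex.vertical_le {R : ℝ} {w : ℝ → ℝ → ℝ → ℝ} (hR : 0 < R) (hR1 : R ≤ 1)
    (hw : HBoxConvex R w) {x y t r q l : ℝ} (hx : |x| ≤ R / 2) (hy : |y| ≤ R / 2)
    (ht : |t| ≤ R / 2) (hr : |r| ≤ R / 8) (hq : |q| ≤ R / 8) (hl : 0 ≤ l) (hl' : l ≤ 1) :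
    2 * w x y (t - 2 * r * (l * q)) ≤
      (1 - l) * (w (x + r) y (t + 2 * r * y) + w (x - r) y (t - 2 * r * y)) +
      l * (w (x + r) (y + q) (t - 2 * r * q + 2 * (r * y - x * q)) +
        w (x - r) (y - q) (t - 2 * r * q - 2 * (r * y - x * q))) := by
  have hs : |l * q| ≤ R / 8 := by
    rw [abs_mul, abs_of_nonneg hl]
    exact (mul_le_of_le_one_left (abs_nonneg q) hl').trans hq
  have prod : ∀ a b : ℝ, |a| ≤ R / 8 → |b| ≤ R / 2 → |a * b| ≤ R / 8 * (1 / 2) := fun a b ha hb => by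
    rw [abs_mul]
    exact mul_le_mul ha (hb.trans (by linarith)) (abs_nonneg _) (by linarith)
  have p1 := abs_le.1 (prod r y hr hy)
  have p2 := abs_le.1 (prod q x hq hx)
  have p3 := abs_le.1 (prod (l * q) x hs hx)
  have p4 := abs_le.1 (prod r q hr (by linarith))
  have p5 := abs_le.1 (prod r (l * q) hr (by linarith))
  rw [abs_le] at hx hy ht hr hq hs
  have k1 := hw (x + r) (y + l * q) (t - 2 * r * (l * q) + 2 * (r * y - x * (l * q)))
    (x - r) (y - l * q) (t - 2 * r * (l * q) - 2 * (r * y - x * (l * q))) (1 / 2)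
    (abs_le.2 ⟨by linarith, by linarith⟩) (abs_le.2 ⟨by linarith, by linarith⟩)
    (abs_le.2 ⟨by linarith, by linarith⟩) (abs_le.2 ⟨by linarith, by linarith⟩)
    (abs_le.2 ⟨by linarith, by linarith⟩) (abs_le.2 ⟨by linarith, by linarith⟩)
    (by ring) (by norm_num) (by norm_num)
  have k2 := hw (x + r) y (t + 2 * r * y) (x + r) (y + q) (t - 2 * r * q + 2 * (r * y - x * q)) l
    (abs_le.2 ⟨by linarith, by linarith⟩) (abs_le.2 ⟨by linarith, by linarith⟩)
    (abs_le.2 ⟨by linarith, by linarith⟩) (abs_le.2 ⟨by linarith, by linarith⟩)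
    (abs_le.2 ⟨by linarith, by linarith⟩) (abs_le.2 ⟨by linarith, by linarith⟩)
    (by ring) hl hl'
  have k3 := hw (x - r) y (t - 2 * r * y) (x - r) (y - q) (t - 2 * r * q - 2 * (r * y - x * q)) l
    (abs_le.2 ⟨by linarith, by linarith⟩) (abs_le.2 ⟨by linarith, by linarith⟩)
    (abs_le.2 ⟨by linarith, by linarith⟩) (abs_le.2 ⟨by linarith, by linarith⟩)
    (abs_le.2 ⟨by linarith, by linarith⟩) (abs_le.2 ⟨by linarith, by linarith⟩)
    (by ring) hl hl'
  ring_nf at k1 k2 k3 ⊢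
  linarith

/-- `w` is bounded above on short vertical segments. -/
lemma HBoxConvex.exists_vertical_bound {R : ℝ} {w : ℝ → ℝ → ℝ → ℝ} (hR : 0 < R) (hR1 : R ≤ 1)
    (hw : HBoxConvex R w) {x y : ℝ} (hx : |x| ≤ R / 2) (hy : |y| ≤ R / 2) :
    ∃ M, ∀ t, |t| ≤ R ^ 2 / 32 → w x y t ≤ M := by
  have hz : |(0 : ℝ)| ≤ R / 2 := by rw [abs_zero]; linarith
  have hr : |R / 8| ≤ R / 8 := (abs_of_pos (by linarith)).le
  have hr' : |-(R / 8)| ≤ R / 8 := by rwa [abs_neg]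
  have side : ∀ q, |q| ≤ R / 8 → ∃ M, ∀ l, 0 ≤ l → l ≤ 1 → w x y (-(2 * (R / 8) * (l * q))) ≤ M :=
    fun q hq => by
      refine ⟨(|w (x + R / 8) y (0 + 2 * (R / 8) * y) + w (x - R / 8) y (0 - 2 * (R / 8) * y)| +
        |w (x + R / 8) (y + q) (0 - 2 * (R / 8) * q + 2 * (R / 8 * y - x * q)) +
        w (x - R / 8) (y - q) (0 - 2 * (R / 8) * q - 2 * (R / 8 * y - x * q))|) / 2,
        fun l hl hl' => ?_⟩
      have k := hw.vertical_le hR hR1 hx hy hz hr hq hl hl'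
      rw [zero_sub] at k
      generalize w (x + R / 8) y _ + w (x - R / 8) y _ = a at k ⊢
      generalize w (x + R / 8) (y + q) _ + w (x - R / 8) (y - q) _ = b at k ⊢
      have h1 : (1 - l) * a ≤ |a| :=
        (mul_le_mul_of_nonneg_left (le_abs_self a) (by linarith)).trans
          (mul_le_of_le_one_left (abs_nonneg a) (by linarith))
      have h2 : l * b ≤ |b| :=
        (mul_le_mul_of_nonneg_left (le_abs_self b) hl).trans
          (mul_le_of_le_one_left (abs_nonneg b) hl')
      linarith
  obtain ⟨M₁, h₁⟩ := side _ hr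
  obtain ⟨M₂, h₂⟩ := side _ hr'
  refine ⟨max M₁ M₂, fun t ht => ?_⟩
  have hl : |t| / (R ^ 2 / 32) ≤ 1 := (div_le_one (by positivity)).2 ht
  have hl0 : 0 ≤ |t| / (R ^ 2 / 32) := by positivity
  rcases le_total t 0 with h | h
  · refine le_max_of_le_left ((h₁ _ hl0 hl).trans' (le_of_eq ?_))
    congr 1
    rw [abs_of_nonpos h]
    field_simp
    ring
  · refine le_max_of_le_right ((h₂ _ hl0 hl).trans' (le_of_eq ?_))
    congr 1
    rw [abs_of_nonneg h]
    field_simp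
    ring

/-- `w` is bounded above near the origin. -/
lemma HBoxConvex.exists_bound {R : ℝ} {w : ℝ → ℝ → ℝ → ℝ} (hR : 0 < R) (hR1 : R ≤ 1)
    (hw : HBoxConvex R w) :
    ∃ M, ∀ x y t, |x| ≤ R ^ 2 / 128 → |y| ≤ R ^ 2 / 128 → |t| ≤ R ^ 2 / 128 → w x y t ≤ M := by
  have hRR : R ^ 2 ≤ R := by nlinarith
  set r : ℝ := R / 32 with hr
  have hr0 : 0 < r := by positivity
  have hrr : r * r = R ^ 2 / 1024 := by rw [hr]; ring
  have c1 : |r| ≤ R / 2 := by rw [abs_of_pos hr0]; linarith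
  have c2 : |-r| ≤ R / 2 := by rwa [abs_neg]
  obtain ⟨M₁, h₁⟩ := hw.exists_vertical_bound hR hR1 c1 c1
  obtain ⟨M₂, h₂⟩ := hw.exists_vertical_bound hR hR1 c1 c2
  obtain ⟨M₃, h₃⟩ := hw.exists_vertical_bound hR hR1 c2 c1
  obtain ⟨M₄, h₄⟩ := hw.exists_vertical_bound hR hR1 c2 c2
  have prod : ∀ a b : ℝ, |a| ≤ r → |b| ≤ r → |a * b| ≤ R ^ 2 / 1024 := fun a b ha hb => by
    rw [abs_mul, ← hrr]
    exact mul_le_mul ha hb (abs_nonneg _) hr0.le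
  have comb : ∀ l a b c : ℝ, 0 ≤ l → l ≤ 1 → a ≤ c → b ≤ c → a + l * (b - a) ≤ c :=
    fun l a b c hl hl' ha hb => by nlinarith
  have hbig : ∀ c, |c| ≤ R ^ 2 / 32 → |c| ≤ R := fun c hc => by linarith
  have hrR : |r| ≤ R := by linarith
  have hrR' : |-r| ≤ R := by linarith
  have frac : ∀ y, |y| ≤ r → 0 ≤ (y + r) / (2 * r) ∧ (y + r) / (2 * r) ≤ 1 := fun y hy => by
    rw [abs_le] at hy
    exact ⟨div_nonneg (by linarith) (by linarith), (div_le_one (by linarith)).2 (by linarith)⟩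
  have edge : ∀ a M M', |a| = r → (∀ t, |t| ≤ R ^ 2 / 32 → w a r t ≤ M) →
      (∀ t, |t| ≤ R ^ 2 / 32 → w a (-r) t ≤ M') →
      ∀ y t, |y| ≤ r → |t| ≤ R ^ 2 / 64 → w a y t ≤ max M M' := by
    intro a M M' ha hM hM' y t hy ht
    have q1 := abs_le.1 (prod a r ha.le (abs_of_pos hr0).le)
    have q2 := abs_le.1 (prod a y ha.le hy)
    have ht' := abs_le.1 ht
    have b1 : |t + 2 * (a * y - a * r)| ≤ R ^ 2 / 32 := abs_le.2 ⟨by linarith, by linarith⟩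
    have b2 : |t + 2 * (a * y + a * r)| ≤ R ^ 2 / 32 := abs_le.2 ⟨by linarith, by linarith⟩
    have haR : |a| ≤ R := by linarith
    obtain ⟨f0, f1⟩ := frac y hy
    have k := hw a (-r) (t + 2 * (a * y + a * r)) a r (t + 2 * (a * y - a * r))
      ((y + r) / (2 * r)) haR hrR' (hbig _ b2) haR hrR (hbig _ b1) (by ring) f0 f1
    rw [show a + (y + r) / (2 * r) * (a - a) = a by ring,
      show -r + (y + r) / (2 * r) * (r - -r) = y by field_simp; ring,
      show t + 2 * (a * y + a * r) + (y + r) / (2 * r) *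
        (t + 2 * (a * y - a * r) - (t + 2 * (a * y + a * r))) = t by field_simp; ring] at k
    exact k.trans (comb _ _ _ _ f0 f1 ((hM' _ b2).trans (le_max_right _ _))
      ((hM _ b1).trans (le_max_left _ _)))
  have e₁ := edge r M₁ M₂ (abs_of_pos hr0) h₁ h₂
  have e₂ := edge (-r) M₃ M₄ (by rw [abs_neg, abs_of_pos hr0]) h₃ h₄
  refine ⟨max (max M₁ M₂) (max M₃ M₄), fun x y t hx hy ht => ?_⟩
  have hx : |x| ≤ r := by linarith
  have hy : |y| ≤ r := by linarith
  have q1 := abs_le.1 (prod r y (abs_of_pos hr0).le hy)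
  have q2 := abs_le.1 (prod x y hx hy)
  have ht' := abs_le.1 ht
  have b1 : |t + 2 * (r * y - x * y)| ≤ R ^ 2 / 64 := abs_le.2 ⟨by linarith, by linarith⟩
  have b2 : |t + 2 * (-r * y - x * y)| ≤ R ^ 2 / 64 := abs_le.2 ⟨by linarith, by linarith⟩
  have hyR : |y| ≤ R := by linarith
  obtain ⟨f0, f1⟩ := frac x hx
  have k := hw (-r) y (t + 2 * (-r * y - x * y)) r y (t + 2 * (r * y - x * y))
    ((x + r) / (2 * r)) hrR' hyR (by linarith) hrR hyR (by linarith) (by ring) f0 f1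
  rw [show -r + (x + r) / (2 * r) * (r - -r) = x by field_simp; ring,
    show y + (x + r) / (2 * r) * (y - y) = y by ring,
    show t + 2 * (-r * y - x * y) + (x + r) / (2 * r) *
      (t + 2 * (r * y - x * y) - (t + 2 * (-r * y - x * y))) = t by field_simp; ring] at k
  exact k.trans (comb _ _ _ _ f0 f1 ((e₂ _ _ hy b2).trans (le_max_right _ _))
    ((e₁ _ _ hy b1).trans (le_max_left _ _)))

/-- `w` is upper semicontinuous along vertical lines. -/
lemma HBoxConvex.vertical_usc {R : ℝ} {w : ℝ → ℝ → ℝ → ℝ} (hR : 0 < R) (hR1 : R ≤ 1)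
    (hw : HBoxConvex R w) {x y : ℝ} (hx : |x| ≤ R / 2) (hy : |y| ≤ R / 2) {η : ℝ} (hη : 0 < η) :
    ∃ δ > 0, ∀ τ, |τ| ≤ δ → w x y τ ≤ w x y 0 + η := by
  have hz : |(0 : ℝ)| ≤ R / 2 := by rw [abs_zero]; linarith
  have small : ∀ c : ℝ, ∃ l : ℝ, 0 < l ∧ l ≤ 1 ∧ l * |c| ≤ η := fun c => by
    refine ⟨min 1 (η / (|c| + 1)), by positivity, min_le_left _ _, ?_⟩
    calc _ ≤ η / (|c| + 1) * |c| := mul_le_mul_of_nonneg_right (min_le_right _ _) (abs_nonneg c)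
      _ ≤ η / (|c| + 1) * (|c| + 1) := by gcongr; linarith
      _ = η := by field_simp
  have hr0 : |R / 8| ≤ R / 8 := (abs_of_pos (by linarith)).le
  have hr0' : |-(R / 8)| ≤ R / 8 := by rwa [abs_neg]
  obtain ⟨r, hr, hr8, hA⟩ : ∃ r, 0 < r ∧ r ≤ R / 8 ∧
      w (x + r) y (0 + 2 * r * y) + w (x - r) y (0 - 2 * r * y) ≤ 2 * w x y 0 + η := by
    obtain ⟨m, hm, hm1, hmc⟩ := small (w (x + R / 8) y (2 * (R / 8) * y) +
      w (x - R / 8) y (-(2 * (R / 8) * y)) - 2 * w x y 0)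
    have hy8 : |R / 8 * y| ≤ R / 8 * (1 / 2) := by
      rw [abs_mul]
      exact mul_le_mul hr0 (by linarith) (abs_nonneg _) (by linarith)
    rw [abs_le] at hy8 hx
    have hzR : |(0 : ℝ)| ≤ R := by rw [abs_zero]; exact hR.le
    have k1 := hw x y 0 (x + R / 8) y (2 * (R / 8) * y) m
      (abs_le.2 ⟨by linarith, by linarith⟩) (by linarith) hzR
      (abs_le.2 ⟨by linarith, by linarith⟩) (by linarith)
      (abs_le.2 ⟨by linarith, by linarith⟩) (by ring) hm.le hm1
    have k2 := hw x y 0 (x - R / 8) y (-(2 * (R / 8) * y)) m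
      (abs_le.2 ⟨by linarith, by linarith⟩) (by linarith) hzR
      (abs_le.2 ⟨by linarith, by linarith⟩) (by linarith)
      (abs_le.2 ⟨by linarith, by linarith⟩) (by ring) hm.le hm1
    refine ⟨m * (R / 8), by positivity, mul_le_of_le_one_left (by linarith) hm1, ?_⟩
    have k3 := (mul_le_mul_of_nonneg_left (le_abs_self (w (x + R / 8) y (2 * (R / 8) * y) +
      w (x - R / 8) y (-(2 * (R / 8) * y)) - 2 * w x y 0)) hm.le).trans hmc
    ring_nf at k1 k2 k3 ⊢
    linarith
  have hr' : |r| ≤ R / 8 := by rwa [abs_of_pos hr]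
  have side : ∀ q, |q| ≤ R / 8 → ∃ l₀ > 0, l₀ ≤ 1 ∧ ∀ l, 0 ≤ l → l ≤ l₀ →
      w x y (-(2 * r * (l * q))) ≤ w x y 0 + η := fun q hq => by
    obtain ⟨m, hm, hm1, hmc⟩ := small (w (x + r) (y + q) (0 - 2 * r * q + 2 * (r * y - x * q)) +
        w (x - r) (y - q) (0 - 2 * r * q - 2 * (r * y - x * q)) -
        (w (x + r) y (0 + 2 * r * y) + w (x - r) y (0 - 2 * r * y)))
    refine ⟨m, hm, hm1, fun l hl hlm => ?_⟩
    have k := hw.vertical_le hR hR1 hx hy hz hr' hq hl (hlm.trans hm1)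
    rw [zero_sub (2 * r * (l * q))] at k
    generalize w (x + r) y _ + w (x - r) y _ = a at k hmc hA
    generalize w (x + r) (y + q) _ + w (x - r) (y - q) _ = b at k hmc
    have h1 : l * (b - a) ≤ l * |b - a| := mul_le_mul_of_nonneg_left (le_abs_self _) hl
    have h2 : l * |b - a| ≤ m * |b - a| := mul_le_mul_of_nonneg_right hlm (abs_nonneg _)
    linarith
  obtain ⟨l₁, hl₁, -, h₁⟩ := side _ hr0
  obtain ⟨l₂, hl₂, -, h₂⟩ := side _ hr0'
  refine ⟨min l₁ l₂ * (2 * r * (R / 8)), by positivity, fun τ hτ => ?_⟩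
  have hpos : 0 < 2 * r * (R / 8) := by positivity
  rw [← div_le_iff₀ hpos] at hτ
  have h0 : 0 ≤ |τ| / (2 * r * (R / 8)) := by positivity
  rcases le_total τ 0 with h | h
  · refine (h₁ _ h0 (hτ.trans (min_le_left _ _))).trans' (le_of_eq ?_)
    congr 1
    rw [abs_of_nonpos h]
    field_simp
  · refine (h₂ _ h0 (hτ.trans (min_le_right _ _))).trans' (le_of_eq ?_)
    congr 1
    rw [abs_of_nonneg h]
    field_simp

/-- A function which is H-convex near the origin has a local horizontal subgradient there. -/
lemma HBoxConvex.exists_subgradient {R : ℝ} {w : ℝ → ℝ → ℝ → ℝ} (hR : 0 < R)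
    (hw : HBoxConvex R w) :
    ∃ r > 0, ∃ p : ℝ × ℝ, ∀ x y, |x| ≤ r → |y| ≤ r →
      w 0 0 0 + (p.1 * x + p.2 * y) ≤ w x y 0 := by
  set S := min R 1 with hS
  have hS0 : 0 < S := lt_min hR one_pos
  have hS1 : S ≤ 1 := min_le_right _ _
  have hSS : S ^ 2 ≤ S := by nlinarith
  have hwS : HBoxConvex S w := hw.mono (min_le_left _ _)
  obtain ⟨M, hM⟩ := hwS.exists_bound hS0 hS1
  have hpos : 0 < S ^ 2 / 128 := by positivity
  exact ⟨_, by positivity, (hwS.mono (by linarith)).exists_subgradient_of_vertical_usc hpos hM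
    fun x y hx hy η hη => hwS.vertical_usc hS0 hS1 (by linarith) (by linarith) hη⟩

/-- Left translates of an H-convex function are H-convex. -/
lemma HConvexOn.hBoxConvex {Ω : Set Hgrp} {u : Hgrp → ℝ} (hu : HConvexOn Ω u) {g : Hgrp} {R : ℝ}
    (hR : ∀ x y t, |x| ≤ R → |y| ≤ R → |t| ≤ R → hmul g (x, y, t) ∈ Ω) :
    HBoxConvex R fun x y t => u (hmul g (x, y, t)) := by
  intro x y t x' y' t' l hx hy ht hx' hy' ht' h hl hl'
  have k := hu _ (hR x y t hx hy ht) (hmul g (x', y', t'))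
    ⟨by simp only [hplane, hmul, mem_ofPred_eq]; rw [h]; ring, hR _ _ _ hx' hy' ht'⟩ l ⟨hl, hl'⟩
  refine le_of_eq_of_le (congrArg u ?_) k
  subst h
  simp only [hmul, hdil, hinv, Prod.mk.injEq]
  refine ⟨by ring, by ring, by ring⟩

lemma exists_hmul_box_subset {Ω : Set Hgrp} (hΩ : IsOpen Ω) {g : Hgrp} (hg : g ∈ Ω) :
    ∃ R > 0, ∀ x y t, |x| ≤ R → |y| ≤ R → |t| ≤ R → hmul g (x, y, t) ∈ Ω := by
  have hc : Continuous (hmul g) := by unfold hmul; fun_prop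
  have h0 : hmul g 0 = g := by simp [hmul]
  obtain ⟨ε, hε, hb⟩ := Metric.isOpen_iff.1 (hΩ.preimage hc) 0 (by rwa [mem_preimage, h0])
  refine ⟨ε / 2, by positivity, fun x y t hx hy ht => hb ?_⟩
  rw [mem_ball_zero_iff]
  refine lt_of_le_of_lt ?_ (half_lt_self hε)
  simp only [Prod.norm_mk, Real.norm_eq_abs, sup_le_iff]
  exact ⟨hx, hy, ht⟩

lemma HConvexOn.hsub_nonempty {Ω : Set Hgrp} (hΩ : IsOpen Ω) {u : Hgrp → ℝ} (hu : HConvexOn Ω u)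
    {g : Hgrp} (hg : g ∈ Ω) : (hsub Ω u g).Nonempty := by
  obtain ⟨R, hR, hbox⟩ := exists_hmul_box_subset hΩ hg
  obtain ⟨r, hr, p, hp⟩ := (hu.hBoxConvex hbox).exists_subgradient hR
  refine ⟨p, fun g' hg' => ?_⟩
  obtain ⟨hplane_mem, -⟩ := id hg'
  set a := g'.1 - g.1 with ha
  set b := g'.2.1 - g.2.1 with hb
  set l := min 1 (r / (|a| + |b| + 1)) with hl
  have hl0 : 0 < l := by positivity
  have hlr : l * (|a| + |b| + 1) ≤ r := by
    rw [← le_div_iff₀ (by positivity)]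
    exact min_le_right _ _
  have hla : |l * a| ≤ r := by
    rw [abs_mul, abs_of_pos hl0]
    nlinarith [mul_nonneg hl0.le (abs_nonneg b)]
  have hlb : |l * b| ≤ r := by
    rw [abs_mul, abs_of_pos hl0]
    nlinarith [mul_nonneg hl0.le (abs_nonneg a)]
  have k1 := hp _ _ hla hlb
  have k2 := hu g hg g' hg' l ⟨hl0.le, min_le_left _ _⟩
  have e0 : hmul g (0, 0, 0) = g := by simp [hmul]
  have e1 : hmul g (hdil l (hmul (hinv g) g')) = hmul g (l * a, l * b, 0) := by
    have ht : g'.2.2 = g.2.2 + 2 * g.2.1 * g'.1 - 2 * g.1 * g'.2.1 := hplane_mem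
    simp only [hmul, hdil, hinv, Prod.mk.injEq, ht, ha, hb]
    refine ⟨by ring, by ring, by ring⟩
  rw [e1] at k2
  rw [e0] at k1
  have k3 : l * (p.1 * a + p.2 * b) ≤ l * (u g' - u g) := by linarith
  have k4 := le_of_mul_le_mul_left k3 hl0
  have k5 : dot p (xi1 g' - xi1 g) = p.1 * a + p.2 * b := rfl
  rw [k5]
  linarith

lemma hConvexOn_of_hsub_nonempty {Ω : Set Hgrp} (hΩ : HConvexSet Ω) {u : Hgrp → ℝ}
    (h : ∀ g ∈ Ω, (hsub Ω u g).Nonempty) : HConvexOn Ω u := by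
  intro g hg g' hg' l hl
  have hmem := hΩ g hg g' hg' l hl
  obtain ⟨p, hp⟩ := h _ hmem
  have ht : g'.2.2 = g.2.2 + 2 * g.2.1 * g'.1 - 2 * g.1 * g'.2.1 := hg'.1
  have k1 := hp g ⟨by
    simp only [hplane, hmul, hdil, hinv, mem_ofPred_eq, ht]; ring, hg⟩
  have k2 := hp g' ⟨by
    simp only [hplane, hmul, hdil, hinv, mem_ofPred_eq, ht]; ring, hg'.2⟩
  have e1 : dot p (xi1 g - xi1 (hmul g (hdil l (hmul (hinv g) g')))) =
      -l * (p.1 * (g'.1 - g.1) + p.2 * (g'.2.1 - g.2.1)) := by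
    simp only [dot, xi1, hmul, hdil, hinv, Prod.fst_sub, Prod.snd_sub]; ring
  have e2 : dot p (xi1 g' - xi1 (hmul g (hdil l (hmul (hinv g) g')))) =
      (1 - l) * (p.1 * (g'.1 - g.1) + p.2 * (g'.2.1 - g.2.1)) := by
    simp only [dot, xi1, hmul, hdil, hinv, Prod.fst_sub, Prod.snd_sub]; ring
  rw [e1] at k1
  rw [e2] at k2
  have k3 := mul_le_mul_of_nonneg_left k1 (sub_nonneg.2 hl.2)
  have k4 := mul_le_mul_of_nonneg_left k2 hl.1
  linarith

/-- `u` is H-convex on an open H-convex `Ω` iff `∂_H u(g) ≠ ∅` for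
every `g ∈ Ω`. -/
theorem stmt4 (Ω : Set Hgrp) (hΩo : IsOpen Ω) (hΩc : HConvexSet Ω) (u : Hgrp → ℝ) :
    HConvexOn Ω u ↔ ∀ g ∈ Ω, (hsub Ω u g).Nonempty :=
  ⟨fun hu _ hg => hu.hsub_nonempty hΩo hg, hConvexOn_of_hsub_nonempty hΩc⟩
end
end

section
/- Let u : ℍ → ℝ be H-convex. Then for every compact set K ⊆ ℍ, the set ∂_H u(K) is a compact subset of ℝ². -/
noncomputable section

open Filter Topology Set
open scoped ENNReal

theorem HConvexOn.le_on_line {u : Hgrp → ℝ} (hu : HConvexOn Set.univ u) (g : Hgrp) (v : ℝ × ℝ)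
    {l : ℝ} (hl : l ∈ Set.Icc (0 : ℝ) 1) :
    u (hmul g (hexp (l • v))) ≤ u g + l * (u (hmul g (hexp v)) - u g) := by
  have h := hu g trivial (hmul g (hexp v))
    ⟨by simp only [hplane, hmul, hexp, Set.mem_ofPred_eq]; ring, trivial⟩ l hl
  have e : hmul g (hdil l (hmul (hinv g) (hmul g (hexp v)))) = hmul g (hexp (l • v)) := by
    simp only [hmul, hdil, hinv, hexp, Prod.smul_fst, Prod.smul_snd, smul_eq_mul]
    ext <;> dsimp only <;> ring
  rwa [e] at h

/-- Convexity along the horizontal line through `q` in direction `v`, with `q` seen as the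
barycentre of a point behind it and a point in front of it. -/
theorem HConvexOn.add_mul_le {u : Hgrp → ℝ} (hu : HConvexOn Set.univ u) (q : Hgrp) (v : ℝ × ℝ)
    {α β : ℝ} (hα : 0 ≤ α) (hβ : 0 ≤ β) :
    (α + β) * u q ≤ β * u (hmul q (hexp (-α • v))) + α * u (hmul q (hexp (β • v))) := by
  rcases (add_nonneg hα hβ).eq_or_lt with h0 | hpos
  · obtain rfl : α = 0 := by linarith
    obtain rfl : β = 0 := by linarith
    simp
  have hne : α + β ≠ 0 := hpos.ne'
  have h := hu.le_on_line (hmul q (hexp (-α • v))) ((α + β) • v) (l := α / (α + β))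
    ⟨by positivity, (div_le_one hpos).2 (by linarith)⟩
  have e1 : hmul (hmul q (hexp (-α • v))) (hexp ((α / (α + β)) • (α + β) • v)) = q := by
    rw [smul_smul, div_mul_cancel₀ _ hne]
    simp only [hmul, hexp, Prod.smul_fst, Prod.smul_snd, smul_eq_mul]
    ext <;> dsimp only <;> ring
  have e2 : hmul (hmul q (hexp (-α • v))) (hexp ((α + β) • v)) = hmul q (hexp (β • v)) := by
    simp only [hmul, hexp, Prod.smul_fst, Prod.smul_snd, smul_eq_mul]
    ext <;> dsimp only <;> ring
  rw [e1, e2] at h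
  have h2 := mul_le_mul_of_nonneg_left h hpos.le
  have h3 : (α + β) * (α / (α + β)) = α := by field_simp
  linear_combination h2 +
    (u (hmul q (hexp (β • v))) - u (hmul q (hexp (-α • v)))) * h3

theorem HConvexOn.le_of_le_of_le {u : Hgrp → ℝ} (hu : HConvexOn Set.univ u) {q a b : Hgrp}
    (v : ℝ × ℝ) {α β M : ℝ} (hα : 0 ≤ α) (hβ : 0 ≤ β) (hpos : 0 < α + β)
    (ea : hmul q (hexp (-α • v)) = a) (eb : hmul q (hexp (β • v)) = b)
    (ha : u a ≤ M) (hb : u b ≤ M) : u q ≤ M := by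
  have h := hu.add_mul_le q v hα hβ
  rw [ea, eb] at h
  refine le_of_mul_le_mul_left ?_ hpos
  nlinarith [mul_le_mul_of_nonneg_left ha hβ, mul_le_mul_of_nonneg_left hb hα]

/-- Four points control `u` on a translate of the ruled surface `x = y t / 2`. -/
theorem HConvexOn.exists_le_on_ruled_surface {u : Hgrp → ℝ} (hu : HConvexOn Set.univ u)
    (g : Hgrp) : ∃ M : ℝ, ∀ y t : ℝ, |y| ≤ 1 → |t| ≤ 2 → u (hmul g (y * t / 2, y, t)) ≤ M := by
  obtain ⟨M, hM⟩ : ∃ M : ℝ, ∀ p ∈ ({(-1, 1, -2), (1, 1, 2), (-1, -1, 2), (1, -1, -2)} :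
      Set Hgrp), u (hmul g p) ≤ M := by
    have hfin : ({(-1, 1, -2), (1, 1, 2), (-1, -1, 2), (1, -1, -2)} : Set Hgrp).Finite :=
      Set.toFinite _
    obtain ⟨M, hM⟩ := (hfin.image fun p => u (hmul g p)).bddAbove
    exact ⟨M, fun p hp => hM ⟨p, hp, rfl⟩⟩
  refine ⟨M, fun y t hy ht => ?_⟩
  rw [abs_le] at hy ht
  have hP : u (hmul g (t / 2, 1, t)) ≤ M := by
    refine hu.le_of_le_of_le (1, 0) (α := 1 + t / 2) (β := 1 - t / 2) (by linarith)
      (by linarith) (by linarith) ?_ ?_ (hM (-1, 1, -2) (by simp)) (hM (1, 1, 2) (by simp)) <;>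
    · simp only [hmul, hexp, Prod.smul_fst, Prod.smul_snd, smul_eq_mul]
      ext <;> dsimp only <;> ring
  have hQ : u (hmul g (-(t / 2), -1, t)) ≤ M := by
    refine hu.le_of_le_of_le (1, 0) (α := 1 - t / 2) (β := 1 + t / 2) (by linarith)
      (by linarith) (by linarith) ?_ ?_ (hM (-1, -1, 2) (by simp)) (hM (1, -1, -2) (by simp)) <;>
    · simp only [hmul, hexp, Prod.smul_fst, Prod.smul_snd, smul_eq_mul]
      ext <;> dsimp only <;> ring
  refine hu.le_of_le_of_le (t / 2, 1) (α := 1 + y) (β := 1 - y) (by linarith)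
    (by linarith) (by linarith) ?_ ?_ hQ hP <;>
  · simp only [hmul, hexp, Prod.smul_fst, Prod.smul_snd, smul_eq_mul]
    ext <;> dsimp only <;> ring

theorem HConvexOn.exists_le_on_box {u : Hgrp → ℝ} (hu : HConvexOn Set.univ u) (g : Hgrp) :
    ∃ M : ℝ, ∀ x y t : ℝ, |x| < 1 / 4 → |y| < 1 / 4 → |t| < 1 / 4 →
      u (hmul g (x, y, t)) ≤ M := by
  obtain ⟨M₁, h₁⟩ := hu.exists_le_on_ruled_surface (hmul g (1, 0, 0))
  obtain ⟨M₂, h₂⟩ := hu.exists_le_on_ruled_surface (hmul g (-1, 0, 0))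
  refine ⟨max M₁ M₂, fun x y t hx hy ht => ?_⟩
  rw [abs_lt] at hx hy ht
  have hyy : y * y ≤ 1 / 16 := by nlinarith
  have hyy0 : 0 ≤ y * y := mul_self_nonneg y
  have hyt : |y * t| ≤ 1 / 16 := by rw [abs_le]; constructor <;> nlinarith
  rw [abs_le] at hyt
  have hd : 0 < 1 - y * y := by linarith
  obtain ⟨r, hr⟩ : ∃ r : ℝ, r * (1 - y * y) = 1 - x + y * (t + 2 * y) / 2 :=
    ⟨_, div_mul_cancel₀ _ hd.ne'⟩
  obtain ⟨s, hs⟩ : ∃ s : ℝ, s * (1 - y * y) = 1 + x - y * (t - 2 * y) / 2 :=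
    ⟨_, div_mul_cancel₀ _ hd.ne'⟩
  have hr0 : 0 < r := by nlinarith
  have hr2 : r < 2 := by nlinarith
  have hs0 : 0 < s := by nlinarith
  have hs2 : s < 2 := by nlinarith
  have hp := h₁ y (t + 2 * y + 2 * r * y) (by rw [abs_le]; constructor <;> linarith)
    (by rw [abs_le]; constructor <;> nlinarith)
  have hm := h₂ y (t - 2 * y - 2 * s * y) (by rw [abs_le]; constructor <;> linarith)
    (by rw [abs_le]; constructor <;> nlinarith)
  refine hu.le_of_le_of_le (1, 0) hs0.le hr0.le (by linarith) ?_ ?_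
    (hm.trans (le_max_right _ _)) (hp.trans (le_max_left _ _))
  · simp only [hmul, hexp, Prod.smul_fst, Prod.smul_snd, smul_eq_mul]
    ext <;> dsimp only
    · linear_combination -hs
    · ring
    · linear_combination (-2 * g.2.1) * hs
  · simp only [hmul, hexp, Prod.smul_fst, Prod.smul_snd, smul_eq_mul]
    ext <;> dsimp only
    · linear_combination hr
    · ring
    · linear_combination (2 * g.2.1) * hr

@[fun_prop]
theorem continuous_hmul : Continuous fun p : Hgrp × Hgrp => hmul p.1 p.2 := by
  unfold hmul; fun_prop

@[fun_prop]
theorem continuous_hinv : Continuous hinv := by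
  unfold hinv; fun_prop

@[fun_prop]
theorem continuous_hexp : Continuous hexp := by
  unfold hexp; fun_prop

theorem hmul_hinv_cancel_left (g h : Hgrp) : hmul g (hmul (hinv g) h) = h := by
  simp only [hmul, hinv]
  ext <;> dsimp only <;> ring

theorem hinv_hmul_self (g : Hgrp) : hmul (hinv g) g = 0 := by
  simp only [hmul, hinv]
  ext <;> dsimp only [Prod.fst_zero, Prod.snd_zero] <;> ring

theorem hmul_hexp_zero (g : Hgrp) : hmul g (hexp 0) = g := by
  simp [hmul, hexp]

theorem HConvexOn.eventually_le {u : Hgrp → ℝ} (hu : HConvexOn Set.univ u) (g : Hgrp) :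
    ∃ M : ℝ, ∀ᶠ q in 𝓝 g, u q ≤ M := by
  obtain ⟨M, hM⟩ := hu.exists_le_on_box g
  refine ⟨M, ?_⟩
  have hc : Continuous fun q => hmul (hinv g) q := by fun_prop
  have hx : ∀ᶠ q in 𝓝 g, |(hmul (hinv g) q).1| < 1 / 4 :=
    ContinuousAt.eventually_lt (by fun_prop) continuousAt_const (by simp [hinv_hmul_self])
  have hy : ∀ᶠ q in 𝓝 g, |(hmul (hinv g) q).2.1| < 1 / 4 :=
    ContinuousAt.eventually_lt (by fun_prop) continuousAt_const (by simp [hinv_hmul_self])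
  have ht : ∀ᶠ q in 𝓝 g, |(hmul (hinv g) q).2.2| < 1 / 4 :=
    ContinuousAt.eventually_lt (by fun_prop) continuousAt_const (by simp [hinv_hmul_self])
  filter_upwards [hx, hy, ht] with q hx hy ht
  exact hmul_hinv_cancel_left g q ▸ hM _ _ _ hx hy ht

/-- A vanishing horizontal step does not change the limit of an H-convex function. -/
theorem HConvexOn.tendsto_hmul_hexp {u : Hgrp → ℝ} (hu : HConvexOn Set.univ u) {ι : Type*}
    {l : Filter ι} {q : ι → Hgrp} {v : ι → ℝ × ℝ} {g : Hgrp} (hq : Tendsto q l (𝓝 g))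
    (hv : Tendsto v l (𝓝 0)) (huq : Tendsto (fun i => u (q i)) l (𝓝 (u g))) :
    Tendsto (fun i => u (hmul (q i) (hexp (v i)))) l (𝓝 (u g)) := by
  obtain ⟨M, hM⟩ := hu.eventually_le g
  have hstep : ∀ c : ℝ, ∀ᶠ i in l, u (hmul (q i) (hexp (c • v i))) ≤ M := fun c => by
    have h : Tendsto (fun i => hmul (q i) (hexp (c • v i))) l (𝓝 (hmul g (hexp (c • 0)))) :=
      (continuous_hmul.tendsto (g, hexp (c • 0))).comp
        (hq.prodMk_nhds ((continuous_hexp.tendsto _).comp (hv.const_smul c)))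
    rw [smul_zero, hmul_hexp_zero] at h
    exact h.eventually hM
  have hMg : u g ≤ M := hM.self_of_nhds
  suffices hdiff : Tendsto (fun i => u (hmul (q i) (hexp (v i))) - u (q i)) l (𝓝 0) by
    simpa using hdiff.add huq
  rw [Metric.tendsto_nhds]
  intro ε hε
  obtain ⟨n, hn, hnε⟩ : ∃ n : ℝ, 1 ≤ n ∧ M - u g + 1 < n * ε := by
    refine ⟨max 1 ((M - u g + 2) / ε), le_max_left _ _, ?_⟩
    have h := mul_le_mul_of_nonneg_right (le_max_right 1 ((M - u g + 2) / ε)) hε.le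
    rw [div_mul_cancel₀ _ hε.ne'] at h
    linarith
  filter_upwards [hstep n, hstep (-n), huq.eventually_const_lt (sub_one_lt (u g))]
    with i h₁ h₂ h₃
  have hn0 : 0 < n := by linarith
  have hup := hu.le_on_line (q i) (n • v i) (l := 1 / n)
    ⟨by positivity, (div_le_one hn0).2 hn⟩
  rw [smul_smul, one_div_mul_cancel hn0.ne', one_smul] at hup
  have hlow := hu.add_mul_le (q i) (v i) hn0.le zero_le_one
  rw [one_smul] at hlow
  have hup' := mul_le_mul_of_nonneg_left hup hn0.le
  have hn1 : n * (1 / n) = 1 := mul_one_div_cancel hn0.ne'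
  have hup'' : n * u (hmul (q i) (hexp (v i))) ≤
      n * u (q i) + (u (hmul (q i) (hexp (n • v i))) - u (q i)) := by
    linear_combination hup' + (u (hmul (q i) (hexp (n • v i))) - u (q i)) * hn1
  rw [Real.dist_eq, sub_zero, abs_lt]
  constructor <;> refine lt_of_mul_lt_mul_left ?_ hn0.le <;> linarith

/-- Every point is reached from every other one by five horizontal steps. -/
theorem hmul_hexp_path (g : Hgrp) (x y t : ℝ) :
    hmul (hmul (hmul (hmul (hmul g (hexp (x, y))) (hexp ((√(-t) - √t) / 4, 0)))
      (hexp (0, √t + √(-t)))) (hexp (-((√(-t) - √t) / 4), 0))) (hexp (0, -(√t + √(-t)))) =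
      hmul g (x, y, t) := by
  have h : √(-t) ^ 2 - √t ^ 2 = -t := by
    rcases le_total 0 t with h0 | h0
    · rw [Real.sqrt_eq_zero_of_nonpos (neg_nonpos.2 h0), Real.sq_sqrt h0]; ring
    · rw [Real.sqrt_eq_zero_of_nonpos h0, Real.sq_sqrt (neg_nonneg.2 h0)]; ring
  simp only [hmul, hexp]
  ext <;> dsimp only
  · ring
  · ring
  · linear_combination -h

theorem HConvexOn.continuous {u : Hgrp → ℝ} (hu : HConvexOn Set.univ u) : Continuous u := by
  refine continuous_iff_continuousAt.2 fun g => ?_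
  have key : ∀ (w : Hgrp → Hgrp) (v : Hgrp → ℝ × ℝ), Continuous w → Continuous v →
      w g = g → v g = 0 → ContinuousAt (fun q => u (w q)) g →
      ContinuousAt (fun q => u (hmul (w q) (hexp (v q)))) g := by
    intro w v hw hv hwg hvg h
    have h1 := hw.tendsto g
    have h2 := hv.tendsto g
    simp only [ContinuousAt, hwg, hvg, hmul_hexp_zero] at h h1 h2 ⊢
    exact hu.tendsto_hmul_hexp h1 h2 h
  have hpath : u = fun q => u (hmul g (hmul (hinv g) q)) := by
    simp only [hmul_hinv_cancel_left]
  rw [hpath]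
  simp only [← hmul_hexp_path g (hmul (hinv g) _).1 (hmul (hinv g) _).2.1 (hmul (hinv g) _).2.2]
  have z : hexp ((0 : ℝ), (0 : ℝ)) = hexp 0 := rfl
  refine key _ _ (by fun_prop) (by fun_prop) ?_ ?_ <| key _ _ (by fun_prop) (by fun_prop) ?_ ?_ <|
    key _ _ (by fun_prop) (by fun_prop) ?_ ?_ <| key _ _ (by fun_prop) (by fun_prop) ?_ ?_ <|
    key _ _ continuous_const (by fun_prop) rfl ?_ continuousAt_const <;>
  simp [hinv_hmul_self, z, hmul_hexp_zero]

theorem isClosed_graph_hsub {u : Hgrp → ℝ} (hu : Continuous u) :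
    IsClosed {z : Hgrp × (ℝ × ℝ) | z.2 ∈ hsub Set.univ u z.1} := by
  have h : {z : Hgrp × (ℝ × ℝ) | z.2 ∈ hsub Set.univ u z.1} = ⋂ w : ℝ × ℝ,
      {z | u z.1 + dot z.2 (w - xi1 z.1) ≤
        u (w.1, w.2, z.1.2.2 + 2 * z.1.2.1 * w.1 - 2 * z.1.1 * w.2)} := by
    ext ⟨g, p⟩
    simp only [Set.mem_iInter, Set.mem_ofPred_eq]
    constructor
    · exact fun hp w => hp (w.1, w.2, _) ⟨rfl, trivial⟩
    · rintro hp ⟨x, y, t⟩ ⟨ht, -⟩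
      have h := hp (x, y)
      rwa [← show t = g.2.2 + 2 * g.2.1 * x - 2 * g.1 * y from ht] at h
  rw [h]
  refine isClosed_iInter fun w => isClosed_le ?_ ?_
  · unfold dot xi1; fun_prop
  · fun_prop

theorem dot_le_of_mem_hsub {u : Hgrp → ℝ} {g : Hgrp} {p : ℝ × ℝ} (hp : p ∈ hsub Set.univ u g)
    (v : ℝ × ℝ) : dot p v ≤ u (hmul g (hexp v)) - u g := by
  have h := hp (hmul g (hexp v))
    ⟨by simp only [hplane, hmul, hexp, Set.mem_ofPred_eq]; ring, trivial⟩
  have e : xi1 (hmul g (hexp v)) - xi1 g = v := by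
    ext <;> simp [xi1, hmul, hexp]
  rw [e] at h
  linarith

theorem exists_norm_le_of_mem_hsubSet {u : Hgrp → ℝ} (hu : Continuous u) {K : Set Hgrp}
    (hK : IsCompact K) : ∃ C : ℝ, ∀ g ∈ K, ∀ p ∈ hsub Set.univ u g, ‖p‖ ≤ C := by
  have hb : ∀ v : ℝ × ℝ, ∃ C : ℝ, ∀ g ∈ K, ∀ p ∈ hsub Set.univ u g, dot p v ≤ C := fun v => by
    obtain ⟨C, hC⟩ := hK.exists_bound_of_continuousOn
      (f := fun g => u (hmul g (hexp v)) - u g) (by fun_prop)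
    exact ⟨C, fun g hg p hp =>
      (dot_le_of_mem_hsub hp v).trans ((le_abs_self _).trans (hC g hg))⟩
  obtain ⟨C₁, h₁⟩ := hb (1, 0)
  obtain ⟨C₂, h₂⟩ := hb (-1, 0)
  obtain ⟨C₃, h₃⟩ := hb (0, 1)
  obtain ⟨C₄, h₄⟩ := hb (0, -1)
  refine ⟨max (max C₁ C₂) (max C₃ C₄), fun g hg p hp => ?_⟩
  have k₁ := h₁ g hg p hp
  have k₂ := h₂ g hg p hp
  have k₃ := h₃ g hg p hp
  have k₄ := h₄ g hg p hp
  simp only [dot, mul_one, mul_zero, mul_neg, add_zero, zero_add] at k₁ k₂ k₃ k₄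
  rw [Prod.norm_def, Real.norm_eq_abs, Real.norm_eq_abs]
  exact max_le_max (max_le_max k₁ k₂) (max_le_max k₃ k₄)

/-- for an H-convex `u : ℍ → ℝ`, the set `∂_H u(K)` is compact for every
compact `K ⊆ ℍ`. -/
theorem stmt10 (u : Hgrp → ℝ) (hu : HConvexOn Set.univ u)
    (K : Set Hgrp) (hK : IsCompact K) :
    IsCompact (hsubSet Set.univ u K) := by
  have hc := hu.continuous
  obtain ⟨C, hC⟩ := exists_norm_le_of_mem_hsubSet hc hK
  have himage : hsubSet Set.univ u K = Prod.snd ''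
      ((K ×ˢ Metric.closedBall (0 : ℝ × ℝ) C) ∩ {z | z.2 ∈ hsub Set.univ u z.1}) := by
    ext p
    simp only [hsubSet, Set.mem_iUnion, Set.mem_image, exists_prop]
    constructor
    · rintro ⟨g, hg, hp⟩
      exact ⟨(g, p), ⟨⟨hg, mem_closedBall_zero_iff.2 (hC g hg p hp)⟩, hp⟩, rfl⟩
    · rintro ⟨z, ⟨⟨hg, -⟩, hp⟩, rfl⟩
      exact ⟨z.1, hg, hp⟩
  rw [himage]
  exact ((hK.prod (isCompact_closedBall 0 C)).inter_right (isClosed_graph_hsub hc)).image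
    continuous_snd
end
end
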